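/- arXiv:1511.09073 — 2 statements merged into one kernel-verified Lean document; each statement's English description precedes it below -/
import Mathlib

section
/- The maximum number of edges of a connected {P,C}-free 3-graph on 10 vertices containing a copy of M equals 19; moreover such a 3-graph has 19 edges if and only if it is isomorphic to the comet Co(10). -/
/-- A 3-graph: a finite vertex set together with a finite set of edges
(intended to be 3-element subsets of the vertex set). -/
structure ThreeGraph where
  verts : Finset ℕ
  edges : Finset (Finset ℕ)

namespace ThreeGraph

/-- `G` is a genuine 3-uniform hypergraph: every edge is a 3-element subset of the vertex set. -/
def IsValid (G : ThreeGraph) : Prop :=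
  ∀ e ∈ G.edges, e.card = 3 ∧ e ⊆ G.verts

/-- `H.ContainsCopy F` means `F ⊆ H`: there is an injective map of the vertices of `F`
into those of `H` carrying every edge of `F` to an edge of `H`. -/
def ContainsCopy (H F : ThreeGraph) : Prop :=
  ∃ f : ℕ → ℕ, Set.InjOn f ↑F.verts ∧ (∀ v ∈ F.verts, f v ∈ H.verts) ∧
    ∀ e ∈ F.edges, e.image f ∈ H.edges

/-- `H.Free F` : `H` contains no copy of `F`. -/
def Free (H F : ThreeGraph) : Prop := ¬ H.ContainsCopy F

/-- `IsoCopy F H` : `H` is isomorphic to `F`. -/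
def IsoCopy (F H : ThreeGraph) : Prop :=
  ∃ f : ℕ → ℕ, Set.InjOn f ↑F.verts ∧ F.verts.image f = H.verts ∧
    F.edges.image (Finset.image f) = H.edges

/-- Connectivity: any two vertices are joined by a sequence of vertices in which
consecutive ones lie in a common edge. -/
def Connected (G : ThreeGraph) : Prop :=
  ∀ u ∈ G.verts, ∀ v ∈ G.verts,
    Relation.ReflTransGen (fun a b => ∃ e ∈ G.edges, a ∈ e ∧ b ∈ e) u v

/-- Shift all vertices by `k`. -/
def shiftBy (G : ThreeGraph) (k : ℕ) : ThreeGraph :=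
  ⟨G.verts.image (· + k), G.edges.image (Finset.image (· + k))⟩

/-- Vertex-disjoint union of two 3-graphs. -/
def dUnion (G H : ThreeGraph) : ThreeGraph :=
  ⟨G.verts ∪ (H.shiftBy (G.verts.sup id + 1)).verts,
   G.edges ∪ (H.shiftBy (G.verts.sup id + 1)).edges⟩

end ThreeGraph

/-- The loose 3-uniform path of length 3. -/
def pathP : ThreeGraph :=
  ⟨{0,1,2,3,4,5,6}, {{0,1,2},{2,3,4},{4,5,6}}⟩

/-- The triangle `C`. -/
def triangleC : ThreeGraph :=
  ⟨{0,1,2,3,4,5}, {{0,1,2},{2,3,4},{4,5,0}}⟩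

/-- The matching `M`: two disjoint edges. -/
def matchingM : ThreeGraph :=
  ⟨{0,1,2,3,4,5}, {{0,1,2},{3,4,5}}⟩

/-- `P_2`: two edges sharing exactly one vertex. -/
def pairP2 : ThreeGraph :=
  ⟨{0,1,2,3,4}, {{0,1,2},{2,3,4}}⟩

/-- The complete 3-graph `K_n`. -/
def KK (n : ℕ) : ThreeGraph :=
  ⟨Finset.range n, (Finset.range n).powersetCard 3⟩

/-- The full star `S_n` with center `0`. -/
def SS (n : ℕ) : ThreeGraph :=
  ⟨Finset.range n, ((Finset.range n).powersetCard 3).filter (fun e => 0 ∈ e)⟩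

/-- `G_1(n)` with `x,y,z,v = 0,1,2,3`. -/
def G1 (n : ℕ) : ThreeGraph :=
  ⟨Finset.range n,
   insert {0,1,2}
     (((Finset.range n).powersetCard 3).filter
       (fun h => 3 ∈ h ∧ (h ∩ ({0,1,2} : Finset ℕ)).Nonempty))⟩

/-- `G_2(n)` with `x,y,z = 0,1,2`. -/
def G2 (n : ℕ) : ThreeGraph :=
  ⟨Finset.range n,
   insert {0,1,2}
     (((Finset.range n).powersetCard 3).filter
       (fun h => (h ∩ ({0,1,2} : Finset ℕ)).card = 2))⟩

/-- `G_3(n)` with `x,y₁,y₂,z₁,z₂ = 0,1,2,3,4`. -/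
def G3 (n : ℕ) : ThreeGraph :=
  ⟨Finset.range n,
   ((({0,1,2,3,4} : Finset ℕ).powersetCard 3) \ {{1,2,3},{1,2,4}}) ∪
     ((Finset.range n \ ({0,1,2,3,4} : Finset ℕ)).biUnion (fun w => {{0,3,w},{0,4,w}}))⟩

/-- `K_5^{+t}`: `K_5` on `{0,…,4}` with `a,b = 0,1` and `t` pendant edges `{0,1,v}`. -/
def K5plus (t : ℕ) : ThreeGraph :=
  ⟨Finset.range (5 + t),
   ((Finset.range 5).powersetCard 3) ∪ ((Finset.Ico 5 (5 + t)).image (fun v => {0,1,v}))⟩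

/-- The comet `Co(n)`: a `K_4` on `{0,1,2,3}` and a full star on `{0} ∪ {4,…,n-1}`
with center `0`. -/
def comet (n : ℕ) : ThreeGraph :=
  ⟨Finset.range n,
   (({0,1,2,3} : Finset ℕ).powersetCard 3) ∪
     (((insert 0 (Finset.Ico 4 n)).powersetCard 3).filter (fun e => 0 ∈ e))⟩

/-- `W = V(H) \ U`. -/
def Wset (H : ThreeGraph) (U : Finset ℕ) : Finset ℕ := H.verts \ U

/-- `W_0`: the vertices of `W` lying in no edge of `H` entirely contained in `W`. -/
def W0set (H : ThreeGraph) (U : Finset ℕ) : Finset ℕ :=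
  (Wset H U).filter (fun v => ∀ e ∈ H.edges, e ⊆ Wset H U → v ∉ e)

/-- `W_1 = W \ W_0`. -/
def W1set (H : ThreeGraph) (U : Finset ℕ) : Finset ℕ :=
  Wset H U \ W0set H U

/-- `H_1`: the edges of `H` meeting both `U` and `W_1`. -/
def H1set (H : ThreeGraph) (U : Finset ℕ) : Finset (Finset ℕ) :=
  H.edges.filter (fun e => (e ∩ U).Nonempty ∧ (e ∩ W1set H U).Nonempty)

/-- `H[U]`: the edges of `H` entirely contained in `U`. -/
def HUset (H : ThreeGraph) (U : Finset ℕ) : Finset (Finset ℕ) :=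
  H.edges.filter (fun e => e ⊆ U)


/-! ### Combinatorics of `P` and `C` in terms of intersections -/

/-- Three edges forming a loose path. -/
def IsP (A B D : Finset ℕ) : Prop := (A ∩ B).card = 1 ∧ (B ∩ D).card = 1 ∧ A ∩ D = ∅

/-- Three edges forming a triangle. -/
def IsC (A B D : Finset ℕ) : Prop :=
  (A ∩ B).card = 1 ∧ (B ∩ D).card = 1 ∧ (A ∩ D).card = 1 ∧ A ∩ B ∩ D = ∅

instance (A B D : Finset ℕ) : Decidable (IsP A B D) := by unfold IsP; infer_instance
instance (A B D : Finset ℕ) : Decidable (IsC A B D) := by unfold IsC; infer_instance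

/-- A function listing seven values. -/
def seven (a b c d e f g : ℕ) : ℕ → ℕ
  | 0 => a | 1 => b | 2 => c | 3 => d | 4 => e | 5 => f | _ => g

/-- Decompose a 3-set with a given element. -/
lemma exists_pair_of_mem {A : Finset ℕ} {p : ℕ} (hA : A.card = 3) (hp : p ∈ A) :
    ∃ x y, x ≠ y ∧ x ≠ p ∧ y ≠ p ∧ A = {x, y, p} := by
  have h : (A.erase p).card = 2 := by rw [Finset.card_erase_of_mem hp, hA]
  obtain ⟨x, y, hxy, h2⟩ := Finset.card_eq_two.1 h
  have hx : x ∈ A.erase p := by rw [h2]; simp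
  have hy : y ∈ A.erase p := by rw [h2]; simp
  refine ⟨x, y, hxy, Finset.ne_of_mem_erase hx, Finset.ne_of_mem_erase hy, ?_⟩
  rw [← Finset.insert_erase hp, h2]
  ext z; simp; tauto

/-- Decompose a 3-set with two given elements. -/
lemma exists_single_of_mem {A : Finset ℕ} {p q : ℕ} (hA : A.card = 3) (hp : p ∈ A) (hq : q ∈ A)
    (hpq : p ≠ q) : ∃ x, x ≠ p ∧ x ≠ q ∧ A = {p, x, q} := by
  obtain ⟨x, y, hxy, hx, hy, rfl⟩ := exists_pair_of_mem hA hp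
  simp only [Finset.mem_insert, Finset.mem_singleton] at hq
  rcases hq with rfl | rfl | rfl
  · exact ⟨y, hy, hxy.symm, by ext z; simp; tauto⟩
  · exact ⟨x, hx, hxy, by ext z; simp; tauto⟩
  · exact absurd rfl hpq

lemma mem_of_inter_eq {A B : Finset ℕ} {p : ℕ} (h : A ∩ B = {p}) :
    p ∈ A ∧ p ∈ B ∧ ∀ z, z ∈ A → z ∈ B → z = p := by
  have h1 : ∀ z, (z ∈ A ∧ z ∈ B) ↔ z = p := by
    intro z
    rw [← Finset.mem_inter, h, Finset.mem_singleton]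
  exact ⟨((h1 p).2 rfl).1, ((h1 p).2 rfl).2, fun z ha hb => (h1 z).1 ⟨ha, hb⟩⟩

lemma contains_P {H : ThreeGraph} (hv : H.IsValid) {A B D : Finset ℕ}
    (hA : A ∈ H.edges) (hB : B ∈ H.edges) (hD : D ∈ H.edges) (h : IsP A B D) :
    H.ContainsCopy pathP := by
  obtain ⟨h1, h2, h3⟩ := h
  obtain ⟨p, hp⟩ := Finset.card_eq_one.1 h1
  obtain ⟨q, hq⟩ := Finset.card_eq_one.1 h2
  obtain ⟨pA, pB, pu⟩ := mem_of_inter_eq hp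
  obtain ⟨qB, qD, qu⟩ := mem_of_inter_eq hq
  have h3' : ∀ z, z ∈ A → z ∉ D := fun z ha hd => by
    have : z ∈ A ∩ D := Finset.mem_inter.2 ⟨ha, hd⟩
    rw [h3] at this; simp at this
  have hpq : p ≠ q := fun hh => h3' p pA (hh ▸ qD)
  have sA := (hv A hA).2
  have sB := (hv B hB).2
  have sD := (hv D hD).2
  obtain ⟨x, y, hxy, hxp, hyp, eA⟩ := exists_pair_of_mem (hv A hA).1 pA
  obtain ⟨z, hzp, hzq, eB⟩ := exists_single_of_mem (hv B hB).1 pB qB hpq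
  obtain ⟨s, t, hst, hsq, htq, eD⟩ := exists_pair_of_mem (hv D hD).1 qD
  have eD' : D = {q, s, t} := by rw [eD]; ext z; simp; tauto
  have xA : x ∈ A := by rw [eA]; simp
  have yA : y ∈ A := by rw [eA]; simp
  have zB : z ∈ B := by rw [eB]; simp
  have sD' : s ∈ D := by rw [eD]; simp
  have tD' : t ∈ D := by rw [eD]; simp
  have n1 : x ≠ z := fun hh => hxp (pu x xA (hh ▸ zB))
  have n2 : y ≠ z := fun hh => hyp (pu y yA (hh ▸ zB))
  have n3 : s ≠ z := fun hh => hsq (qu s (hh ▸ zB) sD')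
  have n4 : t ≠ z := fun hh => htq (qu t (hh ▸ zB) tD')
  have n5 : x ≠ s := fun hh => h3' x xA (hh ▸ sD')
  have n6 : x ≠ t := fun hh => h3' x xA (hh ▸ tD')
  have n7 : y ≠ s := fun hh => h3' y yA (hh ▸ sD')
  have n8 : y ≠ t := fun hh => h3' y yA (hh ▸ tD')
  have n9 : x ≠ q := fun hh => h3' x xA (hh ▸ qD)
  have n10 : y ≠ q := fun hh => h3' y yA (hh ▸ qD)
  have n11 : p ≠ s := fun hh => h3' p pA (hh ▸ sD')
  have n12 : p ≠ t := fun hh => h3' p pA (hh ▸ tD')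
  refine ⟨seven x y p z q s t, ?_, ?_, ?_⟩
  · intro i hi j hj hij
    simp only [pathP, Finset.coe_insert, Finset.coe_singleton, Set.mem_insert_iff,
      Set.mem_singleton_iff] at hi hj
    rcases hi with rfl | rfl | rfl | rfl | rfl | rfl | rfl <;>
    rcases hj with rfl | rfl | rfl | rfl | rfl | rfl | rfl <;>
    simp only [seven] at hij <;> first | rfl |
      exact absurd hij (by assumption) | exact absurd hij.symm (by assumption)
  · intro v hv'
    simp only [pathP, Finset.mem_insert, Finset.mem_singleton] at hv'
    rcases hv' with rfl | rfl | rfl | rfl | rfl | rfl | rfl <;> simp only [seven]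
    exacts [sA xA, sA yA, sA pA, sB zB, sB qB, sD sD', sD tD']
  · intro g hg
    simp only [pathP, Finset.mem_insert, Finset.mem_singleton] at hg
    rcases hg with rfl | rfl | rfl <;>
    simp only [Finset.image_insert, Finset.image_singleton, seven]
    exacts [eA ▸ hA, eB ▸ hB, eD' ▸ hD]

lemma contains_C {H : ThreeGraph} (hv : H.IsValid) {A B D : Finset ℕ}
    (hA : A ∈ H.edges) (hB : B ∈ H.edges) (hD : D ∈ H.edges) (h : IsC A B D) :
    H.ContainsCopy triangleC := by
  obtain ⟨h1, h2, h3, h4⟩ := h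
  obtain ⟨p, hp⟩ := Finset.card_eq_one.1 h1
  obtain ⟨q, hq⟩ := Finset.card_eq_one.1 h2
  obtain ⟨r, hr⟩ := Finset.card_eq_one.1 h3
  obtain ⟨pA, pB, pu⟩ := mem_of_inter_eq hp
  obtain ⟨qB, qD, qu⟩ := mem_of_inter_eq hq
  obtain ⟨rA, rD, ru⟩ := mem_of_inter_eq hr
  have h4' : ∀ z, z ∈ A → z ∈ B → z ∉ D := fun z ha hb hd => by
    have : z ∈ A ∩ B ∩ D := Finset.mem_inter.2 ⟨Finset.mem_inter.2 ⟨ha, hb⟩, hd⟩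
    rw [h4] at this; simp at this
  have hpq : p ≠ q := fun hh => h4' p pA pB (hh ▸ qD)
  have hpr : p ≠ r := fun hh => h4' p pA pB (hh ▸ rD)
  have hqr : q ≠ r := fun hh => h4' q (hh ▸ rA) qB qD
  have sA := (hv A hA).2
  have sB := (hv B hB).2
  have sD := (hv D hD).2
  obtain ⟨x, hxr, hxp, eA⟩ := exists_single_of_mem (hv A hA).1 rA pA hpr.symm
  obtain ⟨y, hyp, hyq, eB⟩ := exists_single_of_mem (hv B hB).1 pB qB hpq
  obtain ⟨z, hzq, hzr, eD⟩ := exists_single_of_mem (hv D hD).1 qD rD hqr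
  have xA : x ∈ A := by rw [eA]; simp
  have yB : y ∈ B := by rw [eB]; simp
  have zD : z ∈ D := by rw [eD]; simp
  have n1 : x ≠ y := fun hh => hxp (pu x xA (hh ▸ yB))
  have n2 : y ≠ z := fun hh => hyq (qu y yB (hh ▸ zD))
  have n3 : x ≠ z := fun hh => hxr (ru x xA (hh ▸ zD))
  have n4 : x ≠ q := fun hh => h4' x xA (hh ▸ qB) (hh ▸ qD)
  have n5 : y ≠ r := fun hh => h4' y (hh ▸ rA) yB (hh ▸ rD)
  have n6 : z ≠ p := fun hh => h4' z (hh ▸ pA) (hh ▸ pB) zD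
  refine ⟨seven r x p y q z 0, ?_, ?_, ?_⟩
  · intro i hi j hj hij
    simp only [triangleC, Finset.coe_insert, Finset.coe_singleton, Set.mem_insert_iff,
      Set.mem_singleton_iff] at hi hj
    rcases hi with rfl | rfl | rfl | rfl | rfl | rfl <;>
    rcases hj with rfl | rfl | rfl | rfl | rfl | rfl <;>
    simp only [seven] at hij <;> first | rfl |
      exact absurd hij (by assumption) | exact absurd hij.symm (by assumption)
  · intro v hv'
    simp only [triangleC, Finset.mem_insert, Finset.mem_singleton] at hv'
    rcases hv' with rfl | rfl | rfl | rfl | rfl | rfl <;> simp only [seven]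
    exacts [sA rA, sA xA, sA pA, sB yB, sB qB, sD zD]
  · intro g hg
    simp only [triangleC, Finset.mem_insert, Finset.mem_singleton] at hg
    rcases hg with rfl | rfl | rfl <;>
    simp only [Finset.image_insert, Finset.image_singleton, seven]
    exacts [eA ▸ hA, eB ▸ hB, eD ▸ hD]

lemma image_inter_sub {f : ℕ → ℕ} {V A B : Finset ℕ} (hf : Set.InjOn f ↑V) (hA : A ⊆ V)
    (hB : B ⊆ V) : A.image f ∩ B.image f = (A ∩ B).image f := by
  rw [Finset.image_inter_of_injOn]
  apply hf.mono
  intro z hz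
  rcases hz with hz | hz
  · exact hA hz
  · exact hB hz

lemma isP_of_contains {H : ThreeGraph} (h : H.ContainsCopy pathP) :
    ∃ A ∈ H.edges, ∃ B ∈ H.edges, ∃ D ∈ H.edges, IsP A B D := by
  obtain ⟨f, hf, -, he⟩ := h
  refine ⟨_, he {0,1,2} (by decide), _, he {2,3,4} (by decide), _, he {4,5,6} (by decide), ?_⟩
  have h1 := image_inter_sub hf (A := {0,1,2}) (B := {2,3,4}) (by decide) (by decide)
  have h2 := image_inter_sub hf (A := {2,3,4}) (B := {4,5,6}) (by decide) (by decide)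
  have h3 := image_inter_sub hf (A := {0,1,2}) (B := {4,5,6}) (by decide) (by decide)
  refine ⟨?_, ?_, ?_⟩
  · rw [h1, show ({0,1,2} ∩ {2,3,4} : Finset ℕ) = {2} by decide]; simp
  · rw [h2, show ({2,3,4} ∩ {4,5,6} : Finset ℕ) = {4} by decide]; simp
  · rw [h3, show ({0,1,2} ∩ {4,5,6} : Finset ℕ) = ∅ by decide]; simp

lemma isC_of_contains {H : ThreeGraph} (h : H.ContainsCopy triangleC) :
    ∃ A ∈ H.edges, ∃ B ∈ H.edges, ∃ D ∈ H.edges, IsC A B D := by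
  obtain ⟨f, hf, -, he⟩ := h
  refine ⟨_, he {0,1,2} (by decide), _, he {2,3,4} (by decide), _, he {4,5,0} (by decide), ?_⟩
  have h1 := image_inter_sub hf (A := {0,1,2}) (B := {2,3,4}) (by decide) (by decide)
  have h2 := image_inter_sub hf (A := {2,3,4}) (B := {4,5,0}) (by decide) (by decide)
  have h3 := image_inter_sub hf (A := {0,1,2}) (B := {4,5,0}) (by decide) (by decide)
  have h4 := image_inter_sub hf (A := {2}) (B := {4,5,0}) (by decide) (by decide)
  have e1 : ({0,1,2} ∩ {2,3,4} : Finset ℕ) = {2} := by decide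
  refine ⟨?_, ?_, ?_, ?_⟩
  · rw [h1, e1]; simp
  · rw [h2, show ({2,3,4} ∩ {4,5,0} : Finset ℕ) = {4} by decide]; simp
  · rw [h3, show ({0,1,2} ∩ {4,5,0} : Finset ℕ) = {0} by decide]; simp
  · rw [h1, e1, h4, show ({2} ∩ {4,5,0} : Finset ℕ) = ∅ by decide]; simp

/-! ### Two disjoint edges joined by a third one -/

lemma exists_linked {H : ThreeGraph} (hc : H.Connected)
    (hM : H.ContainsCopy matchingM) :
    ∃ A ∈ H.edges, ∃ F ∈ H.edges, ∃ G ∈ H.edges,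
      A ∩ F = ∅ ∧ (G ∩ A).Nonempty ∧ (G ∩ F).Nonempty := by
  obtain ⟨f, hf, hfv, he⟩ := hM
  have hA := he {0,1,2} (by decide)
  have hF := he {3,4,5} (by decide)
  have hAF := image_inter_sub hf (A := {0,1,2}) (B := {3,4,5}) (by decide) (by decide)
  rw [show ({0,1,2} ∩ {3,4,5} : Finset ℕ) = ∅ by decide, Finset.image_empty] at hAF
  have hu := hfv 0 (by decide)
  have hw := hfv 3 (by decide)
  have hp := hc _ hu _ hw
  have huA : f 0 ∈ Finset.image f {0,1,2} := by simp
  have hwF : f 3 ∈ Finset.image f {3,4,5} := by simp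
  generalize Finset.image f {0,1,2} = A at *
  generalize Finset.image f {3,4,5} = F at *
  generalize f 3 = w at *
  generalize f 0 = u at *
  clear hu
  induction hp using Relation.ReflTransGen.head_induction_on generalizing A with
  | refl =>
    have : w ∈ A ∩ F := Finset.mem_inter.2 ⟨huA, hwF⟩
    rw [hAF] at this; simp at this
  | head h1 _ ih =>
    obtain ⟨G, hG, h3, h4⟩ := h1
    by_cases hGF : G ∩ F = ∅
    · exact ih G hG hGF h4
    · exact ⟨A, hA, F, hF, G, hG, hAF, ⟨_, Finset.mem_inter.2 ⟨h3, huA⟩⟩,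
        Finset.nonempty_iff_ne_empty.2 hGF⟩

/-- The starting configuration: edges `{a,b,c}`, `{o,a,b}`, `{o,d,e}` on six vertices. -/
def Config (H : ThreeGraph) : Prop :=
  ∃ o a b c d e : ℕ, [o, a, b, c, d, e].Nodup ∧ ({a, b, c} : Finset ℕ) ∈ H.edges ∧
    ({o, a, b} : Finset ℕ) ∈ H.edges ∧ ({o, d, e} : Finset ℕ) ∈ H.edges

lemma config_aux {H : ThreeGraph} (hv : H.IsValid) {A F G : Finset ℕ}
    (hA : A ∈ H.edges) (hF : F ∈ H.edges) (hG : G ∈ H.edges) (hAF : A ∩ F = ∅)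
    (h2 : 2 ≤ (G ∩ A).card) (h1 : (G ∩ F).Nonempty) : Config H := by
  obtain ⟨o, ho⟩ := h1
  obtain ⟨oG, oF⟩ := Finset.mem_inter.1 ho
  obtain ⟨a, ha, b, hb, hab⟩ := Finset.one_lt_card.1 h2
  obtain ⟨aG, aA⟩ := Finset.mem_inter.1 ha
  obtain ⟨bG, bA⟩ := Finset.mem_inter.1 hb
  have hd : ∀ z, z ∈ A → z ∉ F := fun z ha hd => by
    have : z ∈ A ∩ F := Finset.mem_inter.2 ⟨ha, hd⟩
    rw [hAF] at this; simp at this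
  have hoa : o ≠ a := fun hh => hd a aA (hh ▸ oF)
  have hob : o ≠ b := fun hh => hd b bA (hh ▸ oF)
  obtain ⟨c, hca, hcb, eA⟩ := exists_single_of_mem (hv A hA).1 aA bA hab
  obtain ⟨d, e, hde, hdo, heo, eF⟩ := exists_pair_of_mem (hv F hF).1 oF
  have eG : ({o, a, b} : Finset ℕ) = G := by
    apply Finset.eq_of_subset_of_card_le
    · intro z hz
      simp only [Finset.mem_insert, Finset.mem_singleton] at hz
      rcases hz with rfl | rfl | rfl <;> assumption
    · rw [(hv G hG).1, Finset.card_eq_three.2 ⟨o, a, b, hoa, hob, hab, rfl⟩]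
  have cA : c ∈ A := by rw [eA]; simp
  have dF : d ∈ F := by rw [eF]; simp
  have eF' : e ∈ F := by rw [eF]; simp
  have k : ∀ x y, x ∈ A → y ∈ F → x ≠ y := fun x y hx hy hh => hd x hx (hh ▸ hy)
  refine ⟨o, a, b, c, d, e, ?_, ?_, ?_, ?_⟩
  · have := k c o cA oF
    have := k a d aA dF
    have := k b d bA dF
    have := k c d cA dF
    have := k a e aA eF'
    have := k b e bA eF'
    have := k c e cA eF'
    simp only [List.nodup_cons, List.mem_cons, List.not_mem_nil, or_false, not_or, not_false_eq_true,
      List.nodup_nil, and_true]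
    refine ⟨⟨?_, ?_, ?_, ?_, ?_⟩, ⟨?_, ?_, ?_, ?_⟩, ⟨?_, ?_, ?_⟩, ⟨?_, ?_⟩, ?_⟩ <;>
      first | assumption | (apply Ne.symm; assumption)
  · convert hA using 1
    rw [eA]; ext z; simp; tauto
  · rw [eG]; exact hG
  · convert hF using 1
    rw [eF]; ext z; simp; tauto

lemma exists_config {H : ThreeGraph} (hv : H.IsValid) (hc : H.Connected)
    (hP : H.Free pathP) (hM : H.ContainsCopy matchingM) : Config H := by
  obtain ⟨A, hA, F, hF, G, hG, hAF, h1, h2⟩ := exists_linked hc hM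
  have c1 := h1.card_pos
  have c2 := h2.card_pos
  by_cases k1 : 2 ≤ (G ∩ A).card
  · exact config_aux hv hA hF hG hAF k1 h2
  by_cases k2 : 2 ≤ (G ∩ F).card
  · exact config_aux hv hF hA hG (by rw [Finset.inter_comm]; exact hAF) k2 h1
  exfalso
  refine hP (contains_P hv hA hG hF ⟨?_, ?_, hAF⟩)
  · rw [Finset.inter_comm]; omega
  · omega

/-! ### A small certified search on bit masks

An edge on the vertex set `{0,…,9}` is coded by the natural number whose binary digits are
the indicator function of the edge. -/

/-- `n` has exactly one binary digit `1`. -/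
def c1 (n : ℕ) : Bool := !(n == 0) && (n &&& (n - 1)) == 0

/-- The codes of the 120 triples in `{0,…,9}`. -/
def allMasks : List ℕ :=
  (List.range 1024).filter fun m => c1 ((m &&& (m - 1)) &&& ((m &&& (m - 1)) - 1))

/-- The three coded edges form a loose path (in some order) or a triangle. -/
def badB (x y z : ℕ) : Bool :=
  (c1 (x &&& y) && c1 (y &&& z) && (x &&& z) == 0) ||
  (c1 (y &&& x) && c1 (x &&& z) && (y &&& z) == 0) ||
  (c1 (x &&& z) && c1 (z &&& y) && (x &&& y) == 0) ||
  (c1 (x &&& y) && c1 (y &&& z) && c1 (x &&& z) && (x &&& y &&& z) == 0)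

/-- Certificates for upper bounds: branching on an edge, or a packing of conflicts. -/
inductive Cert where
  | leaf (l : List (ℕ × ℕ × ℕ)) : Cert
  | branch (x : ℕ) (a b : Cert) : Cert

/-- Relabel the vertices of a coded edge. -/
def relabelMask (σ : List ℕ) (m : ℕ) : ℕ :=
  (List.range 10).foldl (fun s i => if m.testBit i then s + 2 ^ (σ.getD i 0) else s) 0

/-- Relabel the vertices in a certificate. -/
def Cert.relabel (σ : List ℕ) : Cert → Cert
  | .leaf l => .leaf (l.map fun t =>
      (relabelMask σ t.1, relabelMask σ t.2.1, relabelMask σ t.2.2))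
  | .branch x a b => .branch (relabelMask σ x) (a.relabel σ) (b.relabel σ)

/-- The candidates remaining after `x` joins the list `I` of chosen edges. -/
def restrict (I C : List ℕ) (x : ℕ) : List ℕ :=
  (C.erase x).filter fun c => I.all fun i => !badB i x c

/-- Verify a packing of conflicts; `k` bounds the number of chosen candidates. -/
def leafCheck (I : List ℕ) : List (ℕ × ℕ × ℕ) → List ℕ → ℕ → Bool
  | [], C, k => Nat.ble C.length k
  | t :: l, C, k =>
    badB t.1 t.2.1 t.2.2 &&
    (I.contains t.1 || C.contains t.1) && (I.contains t.2.1 || C.contains t.2.1) &&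
    (I.contains t.2.2 || C.contains t.2.2) &&
    (let Y := C.filter fun c => c == t.1 || c == t.2.1 || c == t.2.2
     Nat.ble Y.length (k + 1) &&
     leafCheck I l (C.filter fun c => !(c == t.1 || c == t.2.1 || c == t.2.2))
       (k + 1 - Y.length))

/-- Verify a certificate for the bound 18. -/
def check : Cert → List ℕ → List ℕ → Bool
  | .leaf l, I, C => Nat.ble I.length 18 && leafCheck I l C (18 - I.length)
  | .branch x a b, I, C =>
    C.contains x && check a (x :: I) (restrict I C x) && check b I (C.erase x)

section soundness

variable {S : ℕ → Bool}

lemma countP_split (p : ℕ → Bool) (C : List ℕ) :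
    C.countP S = (C.filter p).countP S + (C.filter fun c => !p c).countP S := by
  induction C with
  | nil => simp
  | cons a C ih =>
    cases h : p a <;> cases h2 : S a <;> simp [h, h2, ih] <;> omega

lemma leafCheck_sound (hS : ∀ x y z, S x → S y → S z → badB x y z = false) (I : List ℕ)
    (hI : ∀ i ∈ I, S i) :
    ∀ (l : List (ℕ × ℕ × ℕ)) (C : List ℕ) (k : ℕ), leafCheck I l C k = true →
      C.countP S ≤ k := by
  intro l
  induction l with
  | nil =>
    intro C k h
    simp only [leafCheck, Nat.ble_eq] at h
    exact (List.countP_le_length).trans h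
  | cons t l ih =>
    intro C k h
    obtain ⟨x, y, z⟩ := t
    simp only [leafCheck, Bool.and_eq_true, Bool.or_eq_true, List.contains_iff_mem, Nat.ble_eq] at h
    obtain ⟨⟨⟨⟨hb, hx⟩, hy⟩, hz⟩, hk, hr⟩ := h
    have h1 := ih _ _ hr
    have h2 := countP_split (S := S) (fun c => c == x || c == y || c == z) C
    have h3 : ((C.filter fun c => c == x || c == y || c == z).countP S) <
        (C.filter fun c => c == x || c == y || c == z).length := by
      apply lt_of_le_of_ne List.countP_le_length
      intro he
      rw [List.countP_eq_length] at he
      have m : ∀ w, (w ∈ I ∨ w ∈ C) → (w = x ∨ w = y ∨ w = z) → S w = true := by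
        intro w hw hh
        rcases hw with hw | hw
        · exact hI w hw
        · apply he w
          rw [List.mem_filter]
          refine ⟨hw, ?_⟩
          simpa [or_assoc] using hh
      have := hS x y z (m x hx (by simp)) (m y hy (by simp)) (m z hz (by simp))
      rw [this] at hb
      exact absurd hb (by simp)
    omega

lemma countP_erase_of_true {C : List ℕ} {x : ℕ} (hx : x ∈ C) (h : S x = true) :
    C.countP S = (C.erase x).countP S + 1 := by
  rw [(List.perm_cons_erase hx).countP_eq, List.countP_cons_of_pos h]

lemma countP_erase_of_false {C : List ℕ} {x : ℕ} (hx : x ∈ C) (h : ¬ S x = true) :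
    C.countP S = (C.erase x).countP S := by
  rw [(List.perm_cons_erase hx).countP_eq, List.countP_cons_of_neg h]

lemma countP_filter_eq {C : List ℕ} {p : ℕ → Bool} (h : ∀ c ∈ C, S c = true → p c = true) :
    (C.filter p).countP S = C.countP S := by
  rw [List.countP_filter]
  apply List.countP_congr
  intro c hc
  simp only [Bool.and_eq_true]
  exact ⟨fun hh => hh.1, fun hh => ⟨hh, h c hc hh⟩⟩

lemma countP_restrict (hS : ∀ x y z, S x → S y → S z → badB x y z = false) {I C : List ℕ} {x : ℕ}
    (hI : ∀ i ∈ I, S i) (hx : x ∈ C) (h : S x = true) :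
    C.countP S = (restrict I C x).countP S + 1 := by
  rw [countP_erase_of_true hx h, restrict, countP_filter_eq]
  intro c _ hc
  rw [List.all_eq_true]
  intro i hi
  rw [hS i x c (hI i hi) h hc]; rfl

lemma check_sound (hS : ∀ x y z, S x → S y → S z → badB x y z = false) :
    ∀ (c : Cert) (I C : List ℕ), (∀ i ∈ I, S i) → check c I C = true →
      I.length + C.countP S ≤ 18 := by
  intro c
  induction c with
  | leaf l =>
    intro I C hI h
    simp only [check, Bool.and_eq_true, Nat.ble_eq] at h
    have := leafCheck_sound hS I hI _ _ _ h.2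
    omega
  | branch x a b iha ihb =>
    intro I C hI h
    simp only [check, Bool.and_eq_true, List.contains_iff_mem] at h
    obtain ⟨⟨hx, ha⟩, hb⟩ := h
    by_cases hs : S x = true
    · have := iha (x :: I) _ (by
        intro i hi
        rcases List.mem_cons.1 hi with rfl | hi
        · exact hs
        · exact hI i hi) ha
      rw [countP_restrict hS hI hx hs]
      simp only [List.length_cons] at this
      omega
    · rw [countP_erase_of_false hx hs]
      exact ihb I _ hI hb

end soundness

/-- Certificate for an extra edge of type `abd`. -/
def cert_abd : Cert :=
  .branch 97
  (.leaf [(7, 896, 161), (14, 35, 392), (14, 37, 648), (14, 41, 81)])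
  (.branch 161
  (.leaf [(7, 832, 289), (14, 328, 35), (14, 584, 37)])
  (.branch 289
  (.leaf [(7, 704, 545), (14, 200, 35)])
  (.branch 545
  (.leaf [(14, 529, 35)])
  (.branch 41
  (.leaf [])
  (.branch 35
  (.leaf [])
  (.branch 37
  (.leaf [])
  (.branch 56
  (.leaf [(14, 50, 25), (22, 448, 112), (22, 704, 176)])
  (.branch 112
  (.leaf [(22, 896, 176), (14, 50, 392)])
  (.branch 176
  (.leaf [(22, 832, 304)])
  (.branch 304
  (.leaf [])
  (.branch 560
  (.leaf [])
  (.branch 50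
  (.leaf [])
  (.leaf [(14, 21, 200), (7, 448, 81), (7, 704, 145), (14, 832, 392), (7, 896, 273), (14, 19, 328), (7, 25, 584), (14, 529, 648), (14, 776, 52)])))))))))))))

/-- Certificate for an extra edge of type `aod`. -/
def cert_aod : Cert :=
  .leaf [(14, 21, 35), (14, 25, 50), (49, 22, 11), (49, 38, 13), (7, 81, 448), (7, 145, 704)]

/-- Certificate for an extra edge of type `ade`. -/
def cert_ade : Cert :=
  .leaf [(49, 22, 11), (49, 38, 13), (14, 52, 19), (14, 56, 35), (50, 448, 70), (50, 704, 134)]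

/-- Certificate for an extra edge of type `cod`. -/
def cert_cod : Cert :=
  .leaf [(14, 19, 41), (14, 21, 56), (49, 22, 11), (49, 38, 13), (7, 448, 81), (7, 704, 145)]

/-- Certificate for an extra edge of type `cde`. -/
def cert_cde : Cert :=
  .branch 11
  (.leaf [])
  (.branch 13
  (.leaf [])
  (.branch 25
  (.leaf [])
  (.branch 41
  (.leaf [])
  (.branch 193
  (.leaf [])
  (.branch 321
  (.leaf [])
  (.branch 577
  (.leaf [])
  (.branch 385
  (.leaf [])
  (.branch 641
  (.leaf [])
  (.leaf [(56, 70, 200), (56, 134, 392), (14, 112, 328), (14, 176, 648), (14, 896, 584), (49, 262, 769), (56, 518, 776), (22, 304, 448), (38, 560, 704)])))))))))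

/-- Certificate for an extra edge of type `abr`. -/
def cert_abr : Cert :=
  .branch 19
  (.leaf [(19, 134, 896)])
  (.branch 35
  (.leaf [])
  (.branch 50
  (.leaf [])
  (.branch 21
  (.leaf [])
  (.branch 37
  (.leaf [])
  (.branch 52
  (.leaf [])
  (.branch 25
  (.leaf [(7, 448, 81), (7, 704, 145)])
  (.branch 41
  (.leaf [(7, 448, 97)])
  (.branch 81
  (.leaf [(14, 392, 145)])
  (.branch 97
  (.leaf [])
  (.branch 385
  (.leaf [(385, 518, 529), (14, 545, 56), (14, 641, 584)])
  (.branch 641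
  (.leaf [(641, 262, 273), (14, 289, 56)])
  (.branch 769
  (.leaf [(769, 134, 145)])
  (.branch 145
  (.leaf [(145, 262, 289), (145, 518, 545)])
  (.branch 273
  (.leaf [(273, 134, 161)])
  (.branch 529
  (.leaf [])
  (.leaf [(70, 56, 200), (14, 112, 328), (14, 896, 584), (14, 392, 161), (14, 648, 176), (14, 776, 448), (7, 304, 545), (70, 560, 704), (7, 832, 289)]))))))))))))))))

/-- Certificate for an extra edge of type `der`. -/
def cert_der : Cert :=
  .leaf [(49, 70, 11), (14, 56, 81), (49, 134, 13), (112, 262, 448), (112, 518, 704), (7, 176, 97), (14, 304, 392), (14, 560, 776), (49, 22, 641), (112, 38, 832), (7, 50, 385), (7, 52, 769)]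

/-- Certificate for an extra edge of type `crs`. -/
def cert_crs : Cert :=
  .leaf [(49, 262, 769), (200, 518, 776), (49, 22, 193), (200, 38, 56), (14, 273, 328), (7, 529, 304), (14, 289, 392), (7, 545, 704)]

/-- Certificate for an extra edge of type `rst`. -/
def cert_rst : Cert :=
  .branch 193
  (.leaf [])
  (.branch 321
  (.leaf [])
  (.branch 385
  (.leaf [])
  (.branch 19
  (.leaf [])
  (.leaf [(49, 518, 11), (7, 704, 545), (7, 832, 529), (14, 896, 200), (49, 22, 13), (448, 38, 112), (14, 56, 37), (14, 560, 25), (448, 70, 176), (448, 134, 50), (448, 262, 52), (7, 41, 328), (14, 392, 35), (14, 304, 21)]))))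

/-- All certificates, obtained from the nine basic ones by relabelling. -/
def certTable : List (ℕ × Cert) :=
  [(22, Cert.relabel [0, 1, 2, 3, 4, 5, 6, 7, 8, 9] cert_abd),
   (19, Cert.relabel [0, 1, 2, 3, 4, 5, 6, 7, 8, 9] cert_aod),
   (50, Cert.relabel [0, 1, 2, 3, 4, 5, 6, 7, 8, 9] cert_ade),
   (25, Cert.relabel [0, 1, 2, 3, 4, 5, 6, 7, 8, 9] cert_cod),
   (56, Cert.relabel [0, 1, 2, 3, 4, 5, 6, 7, 8, 9] cert_cde),
   (70, Cert.relabel [0, 1, 2, 3, 4, 5, 6, 7, 8, 9] cert_abr),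
   (112, Cert.relabel [0, 1, 2, 3, 4, 5, 6, 7, 8, 9] cert_der),
   (200, Cert.relabel [0, 1, 2, 3, 4, 5, 6, 7, 8, 9] cert_crs),
   (448, Cert.relabel [0, 1, 2, 3, 4, 5, 6, 7, 8, 9] cert_rst),
   (704, Cert.relabel [0, 1, 2, 3, 4, 5, 6, 7, 9, 8] cert_rst),
   (328, Cert.relabel [0, 1, 2, 3, 4, 5, 6, 8, 7, 9] cert_crs),
   (832, Cert.relabel [0, 1, 2, 3, 4, 5, 6, 8, 9, 7] cert_rst),
   (584, Cert.relabel [0, 1, 2, 3, 4, 5, 6, 9, 7, 8] cert_crs),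
   (134, Cert.relabel [0, 1, 2, 3, 4, 5, 7, 6, 8, 9] cert_abr),
   (176, Cert.relabel [0, 1, 2, 3, 4, 5, 7, 6, 8, 9] cert_der),
   (392, Cert.relabel [0, 1, 2, 3, 4, 5, 7, 8, 6, 9] cert_crs),
   (896, Cert.relabel [0, 1, 2, 3, 4, 5, 7, 8, 9, 6] cert_rst),
   (648, Cert.relabel [0, 1, 2, 3, 4, 5, 7, 9, 6, 8] cert_crs),
   (262, Cert.relabel [0, 1, 2, 3, 4, 5, 8, 6, 7, 9] cert_abr),
   (304, Cert.relabel [0, 1, 2, 3, 4, 5, 8, 6, 7, 9] cert_der),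
   (776, Cert.relabel [0, 1, 2, 3, 4, 5, 8, 9, 6, 7] cert_crs),
   (518, Cert.relabel [0, 1, 2, 3, 4, 5, 9, 6, 7, 8] cert_abr),
   (560, Cert.relabel [0, 1, 2, 3, 4, 5, 9, 6, 7, 8] cert_der),
   (38, Cert.relabel [0, 1, 2, 3, 5, 4, 6, 7, 8, 9] cert_abd),
   (35, Cert.relabel [0, 1, 2, 3, 5, 4, 6, 7, 8, 9] cert_aod),
   (41, Cert.relabel [0, 1, 2, 3, 5, 4, 6, 7, 8, 9] cert_cod),
   (21, Cert.relabel [0, 2, 1, 3, 4, 5, 6, 7, 8, 9] cert_aod),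
   (52, Cert.relabel [0, 2, 1, 3, 4, 5, 6, 7, 8, 9] cert_ade),
   (37, Cert.relabel [0, 2, 1, 3, 5, 4, 6, 7, 8, 9] cert_aod)]

/-- Candidates compatible with the edges `{1,2,3}`, `{0,1,2}`, `{0,4,5}` (codes 14, 7, 49). -/
def startC : List ℕ := restrict [7, 14] (restrict [14] (restrict [] allMasks 14) 7) 49

/-- The codes of the edges of the comet. -/
def goodMasks : List ℕ := allMasks.filter fun m =>
  (m &&& 1008) == 0 || ((m &&& 1) == 1 && (m &&& 14) == 0)

lemma start_ok : (allMasks.contains 14 && (restrict [] allMasks 14).contains 7 &&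
    (restrict [14] (restrict [] allMasks 14) 7).contains 49) = true := by
  decide +kernel

lemma table_ok : (certTable.all fun t => startC.contains t.1 &&
    check t.2 [t.1, 49, 7, 14] (restrict [49, 7, 14] startC t.1)) = true := by
  decide +kernel

lemma table_full : (startC.all fun m =>
    goodMasks.contains m || certTable.any fun t => t.1 == m) = true := by
  decide +kernel

lemma good_start : (goodMasks.contains 14 && goodMasks.contains 7 && goodMasks.contains 49) = true := by
  decide +kernel

/-- The combinatorial core. -/
lemma core {S : ℕ → Bool} (hS : ∀ x y z, S x → S y → S z → badB x y z = false)
    (h1 : S 14 = true) (h2 : S 7 = true) (h3 : S 49 = true) (hc : 19 ≤ allMasks.countP S) :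
    ∀ m ∈ allMasks, S m = true → m ∈ goodMasks := by
  have hst := start_ok
  simp only [Bool.and_eq_true, List.contains_iff_mem] at hst
  obtain ⟨⟨s1, s2⟩, s3⟩ := hst
  have k1 := countP_restrict hS (I := []) (by simp) s1 h1
  have k2 := countP_restrict hS (I := [14]) (by simpa using h1) s2 h2
  have k3 := countP_restrict hS (I := [7, 14]) (by simp [h1, h2]) s3 h3
  change _ = startC.countP S + 1 at k3
  have hno : ∀ m ∈ startC, S m = true → m ∈ goodMasks := by
    intro m hm hSm
    by_contra hg
    have ht := List.all_eq_true.1 table_full m hm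
    simp only [Bool.or_eq_true, List.contains_iff_mem, hg, false_or, List.any_eq_true,
      beq_iff_eq] at ht
    obtain ⟨t, ht, rfl⟩ := ht
    have hk := List.all_eq_true.1 table_ok t ht
    simp only [Bool.and_eq_true] at hk
    have hI : ∀ i ∈ [49, 7, 14], S i = true := by simp [h1, h2, h3]
    have hb := check_sound hS t.2 _ _ (by simp [h1, h2, h3, hSm]) hk.2
    have k4 := countP_restrict hS (I := [49, 7, 14]) hI hm hSm
    simp only [List.length_cons, List.length_nil] at hb
    omega
  have hgs := good_start
  simp only [Bool.and_eq_true, List.contains_iff_mem] at hgs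
  have step : ∀ (I C : List ℕ) (x m : ℕ), (∀ i ∈ I, S i = true) → S x = true → S m = true →
      m ∈ C → m = x ∨ m ∈ restrict I C x := by
    intro I C x m hI hx hm hC
    by_cases he : m = x
    · exact Or.inl he
    · refine Or.inr ?_
      rw [restrict, List.mem_filter, List.all_eq_true]
      refine ⟨(List.mem_erase_of_ne he).2 hC, ?_⟩
      intro i hi
      rw [hS i x m (hI i hi) hx hm]; rfl
  intro m hm hSm
  rcases step [] _ 14 m (by simp) h1 hSm hm with rfl | hm
  · exact hgs.1.1
  rcases step [14] _ 7 m (by simp [h1]) h2 hSm hm with rfl | hm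
  · exact hgs.1.2
  rcases step [7, 14] _ 49 m (by simp [h1, h2]) h3 hSm hm with rfl | hm
  · exact hgs.2
  exact hno m hm hSm

/-! ### From bit masks to 3-graphs -/

/-- The set coded by a mask. -/
def decode (m : ℕ) : Finset ℕ := (Finset.range 10).filter fun i => m.testBit i = true

lemma decode_land (x y : ℕ) : decode (x &&& y) = decode x ∩ decode y := by
  ext i
  simp only [decode, Finset.mem_filter, Finset.mem_inter, Nat.testBit_land, Bool.and_eq_true]
  tauto

lemma c1_decode : ∀ n ∈ List.range 1024, c1 n = true → (decode n).card = 1 := by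
  decide +kernel

lemma mem_allMasks_lt {m : ℕ} (h : m ∈ allMasks) : m < 1024 := by
  have := List.mem_of_mem_filter h
  simpa using this

lemma c1_inter {x y : ℕ} (hx : x < 1024) (h : c1 (x &&& y) = true) :
    (decode x ∩ decode y).card = 1 := by
  rw [← decode_land]
  exact c1_decode _ (List.mem_range.2 (lt_of_le_of_lt Nat.and_le_left hx)) h

lemma zero_inter {x y : ℕ} (h : ((x &&& y) == 0) = true) : decode x ∩ decode y = ∅ := by
  rw [← decode_land, beq_iff_eq.1 h]
  decide

lemma badB_sound {x y z : ℕ} (hx : x < 1024) (hy : y < 1024) (hz : z < 1024)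
    (h : badB x y z = true) :
    IsP (decode x) (decode y) (decode z) ∨ IsP (decode y) (decode x) (decode z) ∨
    IsP (decode x) (decode z) (decode y) ∨ IsC (decode x) (decode y) (decode z) := by
  simp only [badB, Bool.or_eq_true, Bool.and_eq_true] at h
  rcases h with ((⟨⟨h1, h2⟩, h3⟩ | ⟨⟨h1, h2⟩, h3⟩) | ⟨⟨h1, h2⟩, h3⟩) | ⟨⟨⟨h1, h2⟩, h3⟩, h4⟩
  · exact Or.inl ⟨c1_inter hx h1, c1_inter hy h2, zero_inter h3⟩
  · exact Or.inr (Or.inl ⟨c1_inter hy h1, c1_inter hx h2, zero_inter h3⟩)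
  · exact Or.inr (Or.inr (Or.inl ⟨c1_inter hx h1, c1_inter hz h2, zero_inter h3⟩))
  · refine Or.inr (Or.inr (Or.inr ⟨c1_inter hx h1, c1_inter hy h2, c1_inter hx h3, ?_⟩))
    rw [← decode_land, zero_inter h4]

lemma encode_ok : ∀ D ∈ (Finset.range 10).powersetCard 3,
    D.sum (fun i => 2 ^ i) ∈ allMasks ∧ decode (D.sum fun i => 2 ^ i) = D := by
  decide +kernel

lemma good_comet : goodMasks.toFinset.image decode = (comet 10).edges := by
  decide +kernel

lemma comet_card : (comet 10).edges.card = 19 := by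
  decide +kernel

lemma decode_sub (m : ℕ) : decode m ⊆ Finset.range 10 := Finset.filter_subset _ _

lemma isP_image {f : ℕ → ℕ} {V A B D : Finset ℕ} (hf : Set.InjOn f ↑V) (hA : A ⊆ V) (hB : B ⊆ V)
    (hD : D ⊆ V) (h : IsP A B D) : IsP (A.image f) (B.image f) (D.image f) := by
  obtain ⟨h1, h2, h3⟩ := h
  refine ⟨?_, ?_, ?_⟩
  · rw [image_inter_sub hf hA hB, Finset.card_image_of_injOn, h1]
    exact hf.mono (fun z hz => hA (Finset.mem_inter.1 hz).1)
  · rw [image_inter_sub hf hB hD, Finset.card_image_of_injOn, h2]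
    exact hf.mono (fun z hz => hB (Finset.mem_inter.1 hz).1)
  · rw [image_inter_sub hf hA hD, h3, Finset.image_empty]

lemma isC_image {f : ℕ → ℕ} {V A B D : Finset ℕ} (hf : Set.InjOn f ↑V) (hA : A ⊆ V) (hB : B ⊆ V)
    (hD : D ⊆ V) (h : IsC A B D) : IsC (A.image f) (B.image f) (D.image f) := by
  obtain ⟨h1, h2, h3, h4⟩ := h
  refine ⟨?_, ?_, ?_, ?_⟩
  · rw [image_inter_sub hf hA hB, Finset.card_image_of_injOn, h1]
    exact hf.mono (fun z hz => hA (Finset.mem_inter.1 hz).1)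
  · rw [image_inter_sub hf hB hD, Finset.card_image_of_injOn, h2]
    exact hf.mono (fun z hz => hB (Finset.mem_inter.1 hz).1)
  · rw [image_inter_sub hf hA hD, Finset.card_image_of_injOn, h3]
    exact hf.mono (fun z hz => hA (Finset.mem_inter.1 hz).1)
  · rw [image_inter_sub hf hA hB,
      image_inter_sub hf (Finset.inter_subset_left.trans hA) hD, h4, Finset.image_empty]

/-- Enumerate the vertices starting with six given ones. -/
lemma exists_enum {V : Finset ℕ} (hV : V.card = 10) {l : List ℕ} (hl : l.Nodup)
    (hsub : ∀ z ∈ l, z ∈ V) :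
    ∃ v : ℕ → ℕ, Set.InjOn v ↑(Finset.range 10) ∧ (Finset.range 10).image v = V ∧
      ∀ i < l.length, v i = l.getD i 0 := by
  let L := l ++ (V \ l.toFinset).toList
  have hnd : L.Nodup := by
    refine List.Nodup.append hl (Finset.nodup_toList _) ?_
    intro z hz hz'
    simp [hz] at hz'
  have hLV : L.toFinset = V := by
    ext z
    simp only [L, List.toFinset_append, Finset.toList_toFinset, Finset.mem_union, List.mem_toFinset,
      Finset.mem_sdiff]
    constructor
    · rintro (h | h)
      · exact hsub z h
      · exact h.1
    · intro h
      by_cases hz : z ∈ l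
      · exact Or.inl hz
      · exact Or.inr ⟨h, hz⟩
  have hlen : L.length = 10 := by
    rw [← hV, ← hLV, List.toFinset_card_of_nodup hnd]
  have hinj : Set.InjOn (fun i => L.getD i 0) ↑(Finset.range 10) := by
    intro i hi j hj hij
    simp only [Finset.coe_range, Set.mem_Iio] at hi hj
    simp only [List.getD_eq_getElem _ _ (hlen ▸ hi), List.getD_eq_getElem _ _ (hlen ▸ hj)] at hij
    exact (hnd.getElem_inj_iff).1 hij
  refine ⟨fun i => L.getD i 0, hinj, ?_, ?_⟩
  · apply Finset.eq_of_subset_of_card_le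
    · intro z hz
      obtain ⟨i, hi, rfl⟩ := Finset.mem_image.1 hz
      have hi' := Finset.mem_range.1 hi
      simp only [List.getD_eq_getElem _ _ (hlen ▸ hi')]
      rw [← hLV, List.mem_toFinset]
      exact List.getElem_mem _
    · rw [Finset.card_image_of_injOn hinj, hV, Finset.card_range]
  · intro i hi
    exact List.getD_append _ _ _ _ hi

lemma main_upper {H : ThreeGraph} (hv : H.IsValid) (hV : H.verts.card = 10) (hc : H.Connected)
    (hP : H.Free pathP) (hC : H.Free triangleC) (hM : H.ContainsCopy matchingM)
    (hcard : 19 ≤ H.edges.card) : ThreeGraph.IsoCopy (comet 10) H := by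
  obtain ⟨o, a, b, c, d, e, hnd, E1, E2, E3⟩ := exists_config hv hc hP hM
  obtain ⟨v, hinj, himg, hval⟩ := exists_enum hV hnd (by
    intro z hz
    simp only [List.mem_cons, List.not_mem_nil, or_false] at hz
    rcases hz with rfl | rfl | rfl | rfl | rfl | rfl
    · exact (hv _ E2).2 (by simp)
    · exact (hv _ E1).2 (by simp)
    · exact (hv _ E1).2 (by simp)
    · exact (hv _ E1).2 (by simp)
    · exact (hv _ E3).2 (by simp)
    · exact (hv _ E3).2 (by simp))
  have v0 : v 0 = o := hval 0 (by simp)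
  have v1 : v 1 = a := hval 1 (by simp)
  have v2 : v 2 = b := hval 2 (by simp)
  have v3 : v 3 = c := hval 3 (by simp)
  have v4 : v 4 = d := hval 4 (by simp)
  have v5 : v 5 = e := hval 5 (by simp)
  classical
  let S : ℕ → Bool := fun m => decide (m < 1024 ∧ (decode m).image v ∈ H.edges)
  have hSd : ∀ m, S m = true ↔ (m < 1024 ∧ (decode m).image v ∈ H.edges) := fun m => by simp [S]
  have hS : ∀ x y z, S x → S y → S z → badB x y z = false := by
    intro x y z hx hy hz
    obtain ⟨lx, hx⟩ := (hSd x).1 hx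
    obtain ⟨ly, hy⟩ := (hSd y).1 hy
    obtain ⟨lz, hz⟩ := (hSd z).1 hz
    by_contra hb
    have dx := decode_sub x
    have dy := decode_sub y
    have dz := decode_sub z
    rcases badB_sound lx ly lz (by simpa using hb) with h | h | h | h
    · exact hP (contains_P hv hx hy hz (isP_image hinj dx dy dz h))
    · exact hP (contains_P hv hy hx hz (isP_image hinj dy dx dz h))
    · exact hP (contains_P hv hx hz hy (isP_image hinj dx dz dy h))
    · exact hC (contains_C hv hx hy hz (isC_image hinj dx dy dz h))
  have hall : ∀ A ∈ H.edges, ∃ m ∈ allMasks, S m = true ∧ (decode m).image v = A := by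
    intro A hA
    obtain ⟨D, hD, hDA⟩ := Finset.subset_image_iff.1 ((hv A hA).2.trans himg.symm.subset)
    have hDc : D.card = 3 := by
      rw [← (hv A hA).1, ← hDA, Finset.card_image_of_injOn (hinj.mono hD)]
    obtain ⟨h1, h2⟩ := encode_ok D (Finset.mem_powersetCard.2 ⟨by simpa using hD, hDc⟩)
    refine ⟨_, h1, ?_, ?_⟩
    · rw [hSd, h2, hDA]
      exact ⟨mem_allMasks_lt h1, hA⟩
    · rw [h2, hDA]
  have hcount : 19 ≤ allMasks.countP S := by
    refine hcard.trans ?_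
    have hsub : H.edges ⊆ ((allMasks.filter S).toFinset).image (fun m => (decode m).image v) := by
      intro A hA
      obtain ⟨m, hm, hs, he⟩ := hall A hA
      exact Finset.mem_image.2 ⟨m, by simp [hm, hs], he⟩
    rw [List.countP_eq_length_filter]
    exact (Finset.card_le_card hsub).trans (Finset.card_image_le.trans (List.toFinset_card_le _))
  have s14 : S 14 = true := by
    rw [hSd, show decode 14 = {1, 2, 3} by decide]
    simpa [v1, v2, v3] using E1
  have s7 : S 7 = true := by
    rw [hSd, show decode 7 = {0, 1, 2} by decide]
    simpa [v0, v1, v2] using E2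
  have s49 : S 49 = true := by
    rw [hSd, show decode 49 = {0, 4, 5} by decide]
    simpa [v0, v4, v5] using E3
  have hgood := core hS s14 s7 s49 hcount
  refine ⟨v, hinj, himg, ?_⟩
  symm
  apply Finset.eq_of_subset_of_card_le
  · intro A hA
    obtain ⟨m, hm, hs, he⟩ := hall A hA
    rw [← he, ← good_comet]
    exact Finset.mem_image_of_mem _
      (Finset.mem_image_of_mem _ (List.mem_toFinset.2 (hgood m hm hs)))
  · exact Finset.card_image_le.trans (comet_card.le.trans hcard)

/-! ### The comet -/

lemma comet_valid : (comet 10).IsValid := by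
  unfold ThreeGraph.IsValid
  decide +kernel

lemma comet_noP : ∀ A ∈ (comet 10).edges, ∀ B ∈ (comet 10).edges, ∀ D ∈ (comet 10).edges,
    ¬ IsP A B D ∧ ¬ IsC A B D := by
  decide +kernel

lemma comet_link : ∀ u ∈ (comet 10).verts, ∃ A ∈ (comet 10).edges, u ∈ A ∧ 0 ∈ A := by
  decide +kernel

lemma comet_connected : (comet 10).Connected := by
  intro u hu w hw
  obtain ⟨A, hA, h1, h2⟩ := comet_link u hu
  obtain ⟨B, hB, h3, h4⟩ := comet_link w hw
  exact (Relation.ReflTransGen.single ⟨A, hA, h1, h2⟩).tail ⟨B, hB, h4, h3⟩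

lemma comet_M : (comet 10).ContainsCopy matchingM := by
  refine ⟨seven 1 2 3 0 4 5 0, ?_, ?_, ?_⟩
  · intro i hi j hj hij
    simp only [matchingM, Finset.coe_insert, Finset.coe_singleton, Set.mem_insert_iff,
      Set.mem_singleton_iff] at hi hj
    rcases hi with rfl | rfl | rfl | rfl | rfl | rfl <;>
    rcases hj with rfl | rfl | rfl | rfl | rfl | rfl <;>
    simp [seven] at hij ⊢
  · decide +kernel
  · decide +kernel

lemma iso_card {H : ThreeGraph} (h : ThreeGraph.IsoCopy (comet 10) H) : H.edges.card = 19 := by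
  obtain ⟨f, hf, -, he⟩ := h
  rw [← he, Finset.card_image_of_injOn, comet_card]
  apply (Finset.image_injOn_powerset_of_injOn hf).mono
  intro A hA
  simpa using (comet_valid A hA).2

/-- The maximum number of edges of a connected `{P,C}`-free 3-graph on 10 vertices
containing `M` equals 19, attained exactly by the comet `Co(10)`. -/
theorem conn_cond_turan_ten :
    IsGreatest {m : ℕ | ∃ H : ThreeGraph, H.IsValid ∧ H.verts.card = 10 ∧
      H.Connected ∧ H.Free pathP ∧ H.Free triangleC ∧
      H.ContainsCopy matchingM ∧ H.edges.card = m} 19 ∧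
    ∀ H : ThreeGraph, H.IsValid → H.verts.card = 10 → H.Connected →
      H.Free pathP → H.Free triangleC → H.ContainsCopy matchingM →
      (H.edges.card = 19 ↔ ThreeGraph.IsoCopy (comet 10) H) := by
  refine ⟨⟨?_, ?_⟩, ?_⟩
  · refine ⟨comet 10, comet_valid, by decide +kernel, comet_connected, ?_, ?_, comet_M, comet_card⟩
    · intro h
      obtain ⟨A, hA, B, hB, D, hD, hh⟩ := isP_of_contains h
      exact (comet_noP A hA B hB D hD).1 hh
    · intro h
      obtain ⟨A, hA, B, hB, D, hD, hh⟩ := isC_of_contains h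
      exact (comet_noP A hA B hB D hD).2 hh
  · rintro m ⟨H, hv, hV, hc, hP, hC, hM, rfl⟩
    by_contra hlt
    have := iso_card (main_upper hv hV hc hP hC hM (by omega))
    omega
  · intro H hv hV hc hP hC hM
    exact ⟨fun h => main_upper hv hV hc hP hC hM h.ge, iso_card⟩
end

section
/- The maximum number of edges of a connected {P,C}-free 3-graph on 11 vertices that contains a copy of M and is not contained in the comet Co(11) equals 18; in particular, every such 3-graph has at most 18 edges. -/
/-! ### A small verified branch-and-bound search

Triples of labels in `{0,…,10}` are encoded as bit masks. -/

namespace Eleven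

/-- The mask has exactly one bit. -/
def one (m : ℕ) : Bool := !(Nat.beq m 0) && Nat.beq (m &&& (m - 1)) 0

/-- `bad a e g h`, with `a = e &&& g`: the three triples form a path or a triangle. -/
def bad (a e g h : ℕ) : Bool :=
  bif Nat.beq a 0 then one (e &&& h) && one (g &&& h)
  else
    one a &&
      (bif one (e &&& h) then
          Nat.beq (g &&& h) 0 || (one (g &&& h) && !(Nat.beq a (e &&& h)))
        else Nat.beq (e &&& h) 0 && one (g &&& h))

/-- Remove from `ca` everything incompatible with `e` and a member of `ch`. -/
def filt (e : ℕ) : List ℕ → List ℕ → List ℕ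
  | [], ca => ca
  | g :: ch, ca =>
    bif (Nat.beq (e &&& g) 0 || one (e &&& g)) then
      filt e ch (ca.filter fun h => !(bad (e &&& g) e g h))
    else filt e ch ca

/-- Follow a branching certificate in preorder; `0` is a leaf. -/
def srch : ℕ → List ℕ → List ℕ → List ℕ → Option (List ℕ)
  | 0, _, _, _ => none
  | _ + 1, [], _, _ => none
  | n + 1, e :: t, ch, ca =>
    bif Nat.beq e 0 then
      (bif Nat.ble (ch.length + ca.length) 18 then some t else none)
    else
      match srch n t (e :: ch) (filt e ch (ca.filter fun h => !(Nat.beq h e))) with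
      | none => none
      | some t' => srch n t' ch (ca.filter fun h => !(Nat.beq h e))

/-- Put the members of the first list into the chosen set. -/
def force : List ℕ → List ℕ → List ℕ → List ℕ → Bool
  | [], t, ch, ca => (srch 200 t ch ca).isSome
  | e :: fs, t, ch, ca =>
    force fs t (e :: ch) (filt e ch (ca.filter fun h => !(Nat.beq h e)))

/-- Masks of all triples. -/
def allc : List ℕ :=
  (List.range 2048).filter fun m =>
    one (m &&& (m - 1) &&& ((m &&& (m - 1)) - 1))

def cert_0_1_4 : List ℕ := [
  25, 88, 896, 0, 1408, 0, 1664, 0, 1792, 0, 0, 152, 1792, 0, 832, 0, 1344, 0, 0, 280, 1600, 0,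
  1664, 0, 0, 536, 1216, 0, 0, 1048, 0, 67, 131, 0, 0, 131, 0, 259, 0, 515, 0, 1027, 0, 41, 0, 49,
  0, 0, 41, 49, 67, 0, 131, 0, 259, 0, 515, 0, 0, 67, 896, 0, 1408, 0, 1664, 0, 1792, 0, 0, 131,
  1792, 0, 832, 0, 1344, 0, 0, 259, 1600, 0, 1664, 0, 0, 515, 1216, 0, 0, 1027, 0, 104, 0, 168, 0,
  296, 0, 552, 0, 1064, 0, 0, 49, 67, 896, 0, 1408, 0, 1664, 0, 1792, 0, 0, 131, 1792, 0, 832, 0,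
  1344, 0, 0, 259, 1600, 0, 1664, 0, 0, 515, 1216, 0, 0, 1027, 0, 112, 0, 176, 0, 304, 0, 560, 0,
  1072, 0, 0, 26, 88, 896, 0, 1408, 0, 1664, 0, 0, 152, 1792, 0, 832, 0, 0, 280, 1600, 0, 0, 536,
  0, 1048, 0, 67, 0, 131, 0, 259, 0, 515, 0, 1027, 0, 28, 0, 0, 42, 104, 896, 0, 1408, 0, 1664, 0,
  0, 168, 1792, 0, 832, 0, 0, 296, 1600, 0, 0, 552, 0, 1064, 0, 67, 0, 131, 0, 259, 0, 515, 0,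
  1027, 0, 0, 50, 67, 896, 0, 1408, 0, 1664, 0, 0, 131, 1792, 0, 832, 0, 0, 259, 1600, 0, 0, 515,
  0, 1027, 0, 112, 0, 176, 0, 304, 0, 560, 0, 0, 28, 88, 152, 0, 280, 0, 0, 152, 280, 0, 0, 280,
  0, 536, 0, 1048, 0, 35, 67, 896, 448, 0, 704, 0, 0, 1408, 448, 0, 0, 1664, 0, 1792, 0, 131, 448,
  0, 0, 0, 131, 832, 448, 0, 0, 1344, 0, 1600, 0, 1792, 0, 0, 259, 704, 0, 1216, 0, 1600, 0, 0,
  515, 448, 0, 1216, 0, 0, 1027, 448, 0, 0, 0, 67, 896, 448, 0, 0, 1408, 0, 1664, 0, 1792, 0, 0,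
  131, 832, 0, 1344, 0, 1600, 0, 0, 259, 704, 0, 1216, 0, 0, 515, 448, 0, 0, 0, 44, 104, 168, 0,
  296, 0, 0, 168, 296, 0, 0, 296, 0, 552, 0, 1064, 0, 35, 67, 896, 448, 0, 0, 1408, 0, 1664, 0,
  1792, 0, 0, 131, 832, 0, 1344, 0, 1600, 0, 0, 259, 704, 0, 1216, 0, 0, 515, 448, 0, 0, 0, 67,
  896, 0, 1408, 0, 1664, 0, 0, 131, 832, 0, 1344, 0, 0, 259, 704, 0, 0, 0, 52, 112, 176, 0, 304,
  0, 0, 176, 304, 0, 0, 304, 0, 560, 0, 1072, 0, 35, 67, 896, 0, 1408, 0, 1664, 0, 0, 131, 832, 0,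
  1344, 0, 0, 259, 704, 0, 0, 0, 67, 896, 0, 1408, 0, 0, 131, 832, 0, 0, 0, 88, 152, 280, 0, 0,
  280, 0, 536, 0, 1048, 0, 896, 388, 0, 644, 0, 0, 1408, 388, 0, 0, 1664, 0, 1792, 0, 35, 67, 131,
  388, 0, 0, 0, 0, 0, 152, 280, 0, 536, 0, 1048, 0, 832, 324, 0, 580, 0, 0, 1344, 324, 0, 0, 1600,
  0, 1792, 0, 35, 67, 324, 0, 0, 0, 0, 280, 536, 0, 1048, 0, 704, 196, 0, 580, 0, 0, 1216, 196, 0,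
  0, 1600, 0, 1664, 0, 35, 67, 196, 0, 0, 0, 0, 536, 1048, 0, 448, 196, 0, 324, 0, 0, 1216, 196,
  0, 0, 1344, 0, 1408, 0, 35, 67, 196, 0, 0, 0, 0, 1048, 448, 196, 0, 324, 0, 0, 704, 196, 0, 0,
  832, 0, 896, 0, 35, 67, 196, 0, 0, 0, 0, 104, 168, 296, 0, 0, 296, 0, 552, 0, 1064, 0, 896, 388,
  0, 0, 1408, 0, 1664, 0, 1792, 0, 0, 168, 296, 0, 552, 0, 1064, 0, 832, 324, 0, 0, 1344, 0, 1600,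
  0, 1792, 0, 0, 296, 552, 0, 1064, 0, 704, 196, 0, 0, 1216, 0, 1600, 0, 1664, 0, 0, 552, 1064, 0,
  448, 196, 0, 0, 1216, 0, 1344, 0, 1408, 0, 0, 1064, 448, 196, 0, 0, 704, 0, 832, 0, 896, 0, 0,
  112, 176, 304, 0, 0, 304, 0, 560, 0, 1072, 0, 896, 0, 1408, 0, 1664, 0, 0, 176, 304, 0, 560, 0,
  1072, 0, 832, 0, 1344, 0, 1600, 0, 0, 304, 560, 0, 1072, 0, 704, 0, 1216, 0, 1600, 0, 0, 560,
  1072, 0, 448, 0, 1216, 0, 1344, 0, 0, 1072, 448, 0, 704, 0, 832, 0, 0, 196, 772, 0, 1284, 0,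
  1540, 0, 1792, 0, 448, 0, 704, 0, 0, 324, 644, 0, 1156, 0, 1540, 0, 1664, 0, 448, 0, 0, 580,
  388, 0, 1156, 0, 1284, 0, 1408, 0, 0, 1092, 388, 0, 644, 0, 772, 0, 0, 388, 1540, 0, 448, 0, 0,
  644, 1284, 0, 0, 1156, 0, 772, 0, 1284, 0, 1540, 0, 35, 67, 896, 0, 1408, 0, 0, 131, 832, 0, 0,
  0, 67, 896, 0, 0, 0]

def cert_0_1_5 : List ℕ := [
  25, 88, 896, 0, 1408, 0, 1664, 0, 1792, 0, 0, 152, 1792, 0, 832, 0, 1344, 0, 0, 280, 1600, 0,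
  1664, 0, 0, 536, 1216, 0, 0, 1048, 0, 67, 131, 0, 0, 131, 0, 259, 0, 515, 0, 1027, 0, 41, 0, 49,
  0, 0, 41, 49, 67, 0, 131, 0, 259, 0, 515, 0, 0, 67, 896, 0, 1408, 0, 1664, 0, 1792, 0, 0, 131,
  1792, 0, 832, 0, 1344, 0, 0, 259, 1600, 0, 1664, 0, 0, 515, 1216, 0, 0, 1027, 0, 104, 0, 168, 0,
  296, 0, 552, 0, 1064, 0, 0, 49, 67, 896, 0, 1408, 0, 1664, 0, 1792, 0, 0, 131, 1792, 0, 832, 0,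
  1344, 0, 0, 259, 1600, 0, 1664, 0, 0, 515, 1216, 0, 0, 1027, 0, 112, 0, 176, 0, 304, 0, 560, 0,
  1072, 0, 0, 26, 88, 896, 0, 1408, 0, 1664, 0, 0, 152, 1792, 0, 832, 0, 0, 280, 1600, 0, 0, 536,
  0, 1048, 0, 67, 0, 131, 0, 259, 0, 515, 0, 1027, 0, 28, 0, 0, 42, 104, 896, 0, 1408, 0, 1664, 0,
  0, 168, 1792, 0, 832, 0, 0, 296, 1600, 0, 0, 552, 0, 1064, 0, 67, 0, 131, 0, 259, 0, 515, 0,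
  1027, 0, 0, 50, 67, 896, 0, 1408, 0, 1664, 0, 0, 131, 1792, 0, 832, 0, 0, 259, 1600, 0, 0, 515,
  0, 1027, 0, 112, 0, 176, 0, 304, 0, 560, 0, 0, 28, 88, 152, 0, 280, 0, 0, 152, 280, 0, 0, 280,
  0, 536, 0, 1048, 0, 19, 67, 896, 448, 0, 704, 0, 0, 1408, 448, 0, 0, 1664, 0, 1792, 0, 131, 448,
  0, 0, 0, 131, 832, 448, 0, 0, 1344, 0, 1600, 0, 1792, 0, 0, 259, 704, 0, 1216, 0, 1600, 0, 0,
  515, 448, 0, 1216, 0, 0, 1027, 448, 0, 0, 0, 67, 896, 448, 0, 0, 1408, 0, 1664, 0, 1792, 0, 0,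
  131, 832, 0, 1344, 0, 1600, 0, 0, 259, 704, 0, 1216, 0, 0, 515, 448, 0, 0, 0, 44, 104, 168, 0,
  296, 0, 0, 168, 296, 0, 0, 296, 0, 552, 0, 1064, 0, 19, 67, 896, 448, 0, 0, 1408, 0, 1664, 0,
  1792, 0, 0, 131, 832, 0, 1344, 0, 1600, 0, 0, 259, 704, 0, 1216, 0, 0, 515, 448, 0, 0, 0, 67,
  896, 0, 1408, 0, 1664, 0, 0, 131, 832, 0, 1344, 0, 0, 259, 704, 0, 0, 0, 52, 112, 176, 0, 304,
  0, 0, 176, 304, 0, 0, 304, 0, 560, 0, 1072, 0, 19, 67, 896, 0, 1408, 0, 1664, 0, 0, 131, 832, 0,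
  1344, 0, 0, 259, 704, 0, 0, 0, 67, 896, 0, 1408, 0, 0, 131, 832, 0, 0, 0, 88, 152, 280, 0, 0,
  280, 0, 536, 0, 1048, 0, 896, 388, 0, 644, 0, 0, 1408, 388, 0, 0, 1664, 0, 1792, 0, 19, 67, 131,
  388, 0, 0, 0, 0, 0, 152, 280, 0, 536, 0, 1048, 0, 832, 324, 0, 580, 0, 0, 1344, 324, 0, 0, 1600,
  0, 1792, 0, 19, 67, 324, 0, 0, 0, 0, 280, 536, 0, 1048, 0, 704, 196, 0, 580, 0, 0, 1216, 196, 0,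
  0, 1600, 0, 1664, 0, 19, 67, 196, 0, 0, 0, 0, 536, 1048, 0, 448, 196, 0, 324, 0, 0, 1216, 196,
  0, 0, 1344, 0, 1408, 0, 19, 67, 196, 0, 0, 0, 0, 1048, 448, 196, 0, 324, 0, 0, 704, 196, 0, 0,
  832, 0, 896, 0, 19, 67, 196, 0, 0, 0, 0, 104, 168, 296, 0, 0, 296, 0, 552, 0, 1064, 0, 896, 388,
  0, 0, 1408, 0, 1664, 0, 1792, 0, 0, 168, 296, 0, 552, 0, 1064, 0, 832, 324, 0, 0, 1344, 0, 1600,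
  0, 1792, 0, 0, 296, 552, 0, 1064, 0, 704, 196, 0, 0, 1216, 0, 1600, 0, 1664, 0, 0, 552, 1064, 0,
  448, 196, 0, 0, 1216, 0, 1344, 0, 1408, 0, 0, 1064, 448, 196, 0, 0, 704, 0, 832, 0, 896, 0, 0,
  112, 176, 304, 0, 0, 304, 0, 560, 0, 1072, 0, 896, 0, 1408, 0, 1664, 0, 0, 176, 304, 0, 560, 0,
  1072, 0, 832, 0, 1344, 0, 1600, 0, 0, 304, 560, 0, 1072, 0, 704, 0, 1216, 0, 1600, 0, 0, 560,
  1072, 0, 448, 0, 1216, 0, 1344, 0, 0, 1072, 448, 0, 704, 0, 832, 0, 0, 196, 772, 0, 1284, 0,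
  1540, 0, 1792, 0, 448, 0, 704, 0, 0, 324, 644, 0, 1156, 0, 1540, 0, 1664, 0, 448, 0, 0, 580,
  388, 0, 1156, 0, 1284, 0, 1408, 0, 0, 1092, 388, 0, 644, 0, 772, 0, 0, 388, 1540, 0, 448, 0, 0,
  644, 1284, 0, 0, 1156, 0, 772, 0, 1284, 0, 1540, 0, 19, 67, 896, 0, 1408, 0, 0, 131, 832, 0, 0,
  0, 67, 896, 0, 0, 0]

def cert_0_3_4 : List ℕ := [
  67, 41, 0, 49, 0, 896, 0, 1408, 0, 1664, 0, 1792, 0, 0, 131, 41, 0, 49, 0, 1792, 0, 832, 0,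
  1344, 0, 0, 259, 41, 0, 49, 0, 1600, 0, 1664, 0, 0, 515, 41, 0, 49, 0, 1216, 0, 0, 1027, 41, 0,
  49, 0, 0, 88, 152, 0, 0, 152, 0, 280, 0, 536, 0, 1048, 0, 19, 41, 0, 49, 0, 0, 35, 41, 0, 0, 41,
  0, 49, 0, 0]

def cert_0_3_5 : List ℕ := [
  67, 25, 0, 49, 0, 896, 0, 1408, 0, 1664, 0, 1792, 0, 0, 131, 25, 0, 49, 0, 1792, 0, 832, 0,
  1344, 0, 0, 259, 25, 0, 49, 0, 1600, 0, 1664, 0, 0, 515, 25, 0, 49, 0, 1216, 0, 0, 1027, 25, 0,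
  49, 0, 0, 104, 168, 0, 0, 168, 0, 296, 0, 552, 0, 1064, 0, 19, 25, 0, 49, 0, 0, 35, 25, 0, 0,
  25, 0, 49, 0, 0]

def cert_0_4_5 : List ℕ := [
  67, 25, 0, 41, 0, 131, 1792, 0, 0, 259, 0, 515, 0, 1027, 0, 0, 131, 25, 0, 41, 0, 259, 0, 515,
  0, 1027, 0, 0, 259, 25, 0, 41, 0, 515, 0, 1027, 0, 0, 515, 25, 0, 41, 0, 1027, 0, 0, 1027, 25,
  0, 41, 0, 0, 25, 19, 0, 35, 0, 0, 41, 19, 0, 0, 19, 112, 0, 176, 0, 304, 0, 560, 0, 1072, 0, 0,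
  35, 112, 0, 176, 0, 304, 0, 560, 0, 0, 13, 14, 50, 52, 112, 896, 448, 0, 704, 0, 0, 1408, 448,
  0, 0, 1664, 0, 1792, 0, 176, 448, 0, 0, 0, 176, 832, 448, 0, 0, 1344, 0, 1600, 0, 1792, 0, 0,
  304, 704, 0, 1216, 0, 1600, 0, 0, 560, 448, 0, 1216, 0, 0, 1072, 448, 0, 0, 0, 112, 896, 448, 0,
  0, 1408, 0, 1664, 0, 1792, 0, 0, 176, 832, 0, 1344, 0, 1600, 0, 0, 304, 704, 0, 1216, 0, 0, 560,
  448, 0, 0, 0, 52, 112, 896, 448, 0, 0, 1408, 0, 1664, 0, 1792, 0, 0, 176, 832, 0, 1344, 0, 1600,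
  0, 0, 304, 704, 0, 1216, 0, 0, 560, 448, 0, 0, 0, 112, 896, 0, 1408, 0, 1664, 0, 0, 176, 832, 0,
  1344, 0, 0, 304, 704, 0, 0, 0, 50, 52, 112, 896, 448, 0, 0, 1408, 0, 1664, 0, 1792, 0, 0, 176,
  832, 0, 1344, 0, 1600, 0, 0, 304, 704, 0, 1216, 0, 0, 560, 448, 0, 0, 0, 112, 896, 0, 1408, 0,
  1664, 0, 0, 176, 832, 0, 1344, 0, 0, 304, 704, 0, 0, 0, 52, 112, 896, 0, 1408, 0, 1664, 0, 0,
  176, 832, 0, 1344, 0, 0, 304, 704, 0, 0, 0, 112, 896, 0, 1408, 0, 0, 176, 832, 0, 0, 0, 14, 50,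
  52, 112, 896, 448, 0, 0, 1408, 0, 1664, 0, 1792, 0, 0, 176, 832, 0, 1344, 0, 1600, 0, 0, 304,
  704, 0, 1216, 0, 0, 560, 448, 0, 0, 0, 112, 896, 0, 1408, 0, 1664, 0, 0, 176, 832, 0, 1344, 0,
  0, 304, 704, 0, 0, 0, 52, 112, 896, 0, 1408, 0, 1664, 0, 0, 176, 832, 0, 1344, 0, 0, 304, 704,
  0, 0, 0, 112, 896, 0, 1408, 0, 0, 176, 832, 0, 0, 0, 50, 52, 112, 896, 0, 1408, 0, 1664, 0, 0,
  176, 832, 0, 1344, 0, 0, 304, 704, 0, 0, 0, 112, 896, 0, 1408, 0, 0, 176, 832, 0, 0, 0, 52, 112,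
  896, 0, 1408, 0, 0, 176, 832, 0, 0, 0, 112, 896, 0, 0, 0]

def cert_1_3_4 : List ℕ := [
  67, 42, 0, 50, 0, 896, 0, 1408, 0, 1664, 0, 1792, 0, 0, 131, 42, 0, 50, 0, 1792, 0, 832, 0,
  1344, 0, 0, 259, 42, 0, 50, 0, 1600, 0, 1664, 0, 0, 515, 42, 0, 50, 0, 1216, 0, 0, 1027, 42, 0,
  50, 0, 0, 88, 152, 0, 0, 152, 0, 280, 0, 536, 0, 1048, 0, 19, 25, 0, 28, 0, 0, 35, 25, 0, 0, 25,
  0, 28, 0, 0]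

def cert_1_3_5 : List ℕ := [
  67, 26, 0, 50, 0, 896, 0, 1408, 0, 1664, 0, 1792, 0, 0, 131, 26, 0, 50, 0, 1792, 0, 832, 0,
  1344, 0, 0, 259, 26, 0, 50, 0, 1600, 0, 1664, 0, 0, 515, 26, 0, 50, 0, 1216, 0, 0, 1027, 26, 0,
  50, 0, 0, 104, 168, 0, 0, 168, 0, 296, 0, 552, 0, 1064, 0, 19, 41, 0, 44, 0, 0, 35, 41, 0, 0,
  41, 0, 44, 0, 0]

def cert_1_4_5 : List ℕ := [
  67, 26, 0, 42, 0, 131, 1792, 0, 0, 259, 0, 515, 0, 1027, 0, 0, 131, 26, 0, 42, 0, 259, 0, 515,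
  0, 1027, 0, 0, 259, 26, 0, 42, 0, 515, 0, 1027, 0, 0, 515, 26, 0, 42, 0, 1027, 0, 0, 1027, 26,
  0, 42, 0, 0, 26, 19, 0, 35, 0, 0, 42, 19, 0, 0, 19, 112, 0, 176, 0, 304, 0, 560, 0, 1072, 0, 0,
  35, 112, 0, 176, 0, 304, 0, 560, 0, 0, 13, 49, 14, 52, 112, 896, 448, 0, 704, 0, 0, 1408, 448,
  0, 0, 1664, 0, 1792, 0, 176, 448, 0, 0, 0, 176, 832, 448, 0, 0, 1344, 0, 1600, 0, 1792, 0, 0,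
  304, 704, 0, 1216, 0, 1600, 0, 0, 560, 448, 0, 1216, 0, 0, 1072, 448, 0, 0, 0, 112, 896, 448, 0,
  0, 1408, 0, 1664, 0, 1792, 0, 0, 176, 832, 0, 1344, 0, 1600, 0, 0, 304, 704, 0, 1216, 0, 0, 560,
  448, 0, 0, 0, 52, 112, 896, 448, 0, 0, 1408, 0, 1664, 0, 1792, 0, 0, 176, 832, 0, 1344, 0, 1600,
  0, 0, 304, 704, 0, 1216, 0, 0, 560, 448, 0, 0, 0, 112, 896, 0, 1408, 0, 1664, 0, 0, 176, 832, 0,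
  1344, 0, 0, 304, 704, 0, 0, 0, 14, 52, 112, 896, 448, 0, 0, 1408, 0, 1664, 0, 1792, 0, 0, 176,
  832, 0, 1344, 0, 1600, 0, 0, 304, 704, 0, 1216, 0, 0, 560, 448, 0, 0, 0, 112, 896, 0, 1408, 0,
  1664, 0, 0, 176, 832, 0, 1344, 0, 0, 304, 704, 0, 0, 0, 52, 112, 896, 0, 1408, 0, 1664, 0, 0,
  176, 832, 0, 1344, 0, 0, 304, 704, 0, 0, 0, 112, 896, 0, 1408, 0, 0, 176, 832, 0, 0, 0, 49, 14,
  52, 112, 896, 448, 0, 0, 1408, 0, 1664, 0, 1792, 0, 0, 176, 832, 0, 1344, 0, 1600, 0, 0, 304,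
  704, 0, 1216, 0, 0, 560, 448, 0, 0, 0, 112, 896, 0, 1408, 0, 1664, 0, 0, 176, 832, 0, 1344, 0,
  0, 304, 704, 0, 0, 0, 52, 112, 896, 0, 1408, 0, 1664, 0, 0, 176, 832, 0, 1344, 0, 0, 304, 704,
  0, 0, 0, 112, 896, 0, 1408, 0, 0, 176, 832, 0, 0, 0, 14, 52, 112, 896, 0, 1408, 0, 1664, 0, 0,
  176, 832, 0, 1344, 0, 0, 304, 704, 0, 0, 0, 112, 896, 0, 1408, 0, 0, 176, 832, 0, 0, 0, 52, 112,
  896, 0, 1408, 0, 0, 176, 832, 0, 0, 0, 112, 896, 0, 0, 0]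

def cert_2_3_4 : List ℕ := [
  88, 13, 0, 14, 0, 152, 1792, 0, 0, 280, 0, 536, 0, 1048, 0, 0, 152, 13, 0, 14, 0, 280, 0, 536,
  0, 1048, 0, 0, 280, 13, 0, 14, 0, 536, 0, 1048, 0, 0, 536, 13, 0, 14, 0, 1048, 0, 0, 1048, 13,
  0, 14, 0, 0, 13, 25, 0, 26, 0, 0, 14, 25, 0, 0, 25, 67, 0, 131, 0, 259, 0, 515, 0, 1027, 0, 0,
  26, 67, 0, 131, 0, 259, 0, 515, 0, 0, 19, 35, 67, 896, 448, 0, 704, 0, 0, 1408, 448, 0, 0, 1664,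
  0, 1792, 0, 131, 448, 0, 0, 0, 131, 832, 448, 0, 0, 1344, 0, 1600, 0, 1792, 0, 0, 259, 704, 0,
  1216, 0, 1600, 0, 0, 515, 448, 0, 1216, 0, 0, 1027, 448, 0, 0, 0, 67, 896, 448, 0, 0, 1408, 0,
  1664, 0, 1792, 0, 0, 131, 832, 0, 1344, 0, 1600, 0, 0, 259, 704, 0, 1216, 0, 0, 515, 448, 0, 0,
  0, 35, 67, 896, 448, 0, 0, 1408, 0, 1664, 0, 1792, 0, 0, 131, 832, 0, 1344, 0, 1600, 0, 0, 259,
  704, 0, 1216, 0, 0, 515, 448, 0, 0, 0, 67, 896, 0, 1408, 0, 1664, 0, 0, 131, 832, 0, 1344, 0, 0,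
  259, 704, 0, 0, 0]

def cert_2_3_5 : List ℕ := [
  104, 13, 0, 14, 0, 168, 1792, 0, 0, 296, 0, 552, 0, 1064, 0, 0, 168, 13, 0, 14, 0, 296, 0, 552,
  0, 1064, 0, 0, 296, 13, 0, 14, 0, 552, 0, 1064, 0, 0, 552, 13, 0, 14, 0, 1064, 0, 0, 1064, 13,
  0, 14, 0, 0, 13, 41, 0, 42, 0, 0, 14, 41, 0, 0, 41, 67, 0, 131, 0, 259, 0, 515, 0, 1027, 0, 0,
  42, 67, 0, 131, 0, 259, 0, 515, 0, 0, 19, 35, 67, 896, 448, 0, 704, 0, 0, 1408, 448, 0, 0, 1664,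
  0, 1792, 0, 131, 448, 0, 0, 0, 131, 832, 448, 0, 0, 1344, 0, 1600, 0, 1792, 0, 0, 259, 704, 0,
  1216, 0, 1600, 0, 0, 515, 448, 0, 1216, 0, 0, 1027, 448, 0, 0, 0, 67, 896, 448, 0, 0, 1408, 0,
  1664, 0, 1792, 0, 0, 131, 832, 0, 1344, 0, 1600, 0, 0, 259, 704, 0, 1216, 0, 0, 515, 448, 0, 0,
  0, 35, 67, 896, 448, 0, 0, 1408, 0, 1664, 0, 1792, 0, 0, 131, 832, 0, 1344, 0, 1600, 0, 0, 259,
  704, 0, 1216, 0, 0, 515, 448, 0, 0, 0, 67, 896, 0, 1408, 0, 1664, 0, 0, 131, 832, 0, 1344, 0, 0,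
  259, 704, 0, 0, 0]

def cert_2_4_5 : List ℕ := [
  13, 28, 0, 44, 0, 49, 14, 50, 112, 896, 448, 0, 704, 0, 0, 1408, 448, 0, 0, 1664, 0, 1792, 0,
  176, 448, 0, 0, 0, 176, 832, 448, 0, 0, 1344, 0, 1600, 0, 1792, 0, 0, 304, 704, 0, 1216, 0,
  1600, 0, 0, 560, 448, 0, 1216, 0, 0, 1072, 448, 0, 0, 0, 112, 896, 448, 0, 0, 1408, 0, 1664, 0,
  1792, 0, 0, 176, 832, 0, 1344, 0, 1600, 0, 0, 304, 704, 0, 1216, 0, 0, 560, 448, 0, 0, 0, 50,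
  112, 896, 448, 0, 0, 1408, 0, 1664, 0, 1792, 0, 0, 176, 832, 0, 1344, 0, 1600, 0, 0, 304, 704,
  0, 1216, 0, 0, 560, 448, 0, 0, 0, 112, 896, 0, 1408, 0, 1664, 0, 0, 176, 832, 0, 1344, 0, 0,
  304, 704, 0, 0, 0, 14, 50, 112, 896, 448, 0, 0, 1408, 0, 1664, 0, 1792, 0, 0, 176, 832, 0, 1344,
  0, 1600, 0, 0, 304, 704, 0, 1216, 0, 0, 560, 448, 0, 0, 0, 112, 896, 0, 1408, 0, 1664, 0, 0,
  176, 832, 0, 1344, 0, 0, 304, 704, 0, 0, 0, 50, 112, 896, 0, 1408, 0, 1664, 0, 0, 176, 832, 0,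
  1344, 0, 0, 304, 704, 0, 0, 0, 112, 896, 0, 1408, 0, 0, 176, 832, 0, 0, 0, 14, 28, 0, 44, 0, 49,
  50, 112, 896, 448, 0, 0, 1408, 0, 1664, 0, 1792, 0, 0, 176, 832, 0, 1344, 0, 1600, 0, 0, 304,
  704, 0, 1216, 0, 0, 560, 448, 0, 0, 0, 112, 896, 0, 1408, 0, 1664, 0, 0, 176, 832, 0, 1344, 0,
  0, 304, 704, 0, 0, 0, 50, 112, 896, 0, 1408, 0, 1664, 0, 0, 176, 832, 0, 1344, 0, 0, 304, 704,
  0, 0, 0, 112, 896, 0, 1408, 0, 0, 176, 832, 0, 0, 0, 28, 19, 35, 67, 896, 448, 0, 704, 0, 0,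
  1408, 448, 0, 0, 1664, 0, 1792, 0, 131, 448, 0, 0, 0, 131, 832, 448, 0, 0, 1344, 0, 1600, 0,
  1792, 0, 0, 259, 704, 0, 1216, 0, 1600, 0, 0, 515, 448, 0, 1216, 0, 0, 1027, 448, 0, 0, 0, 67,
  896, 448, 0, 0, 1408, 0, 1664, 0, 1792, 0, 0, 131, 832, 0, 1344, 0, 1600, 0, 0, 259, 704, 0,
  1216, 0, 0, 515, 448, 0, 0, 0, 35, 67, 896, 448, 0, 0, 1408, 0, 1664, 0, 1792, 0, 0, 131, 832,
  0, 1344, 0, 1600, 0, 0, 259, 704, 0, 1216, 0, 0, 515, 448, 0, 0, 0, 67, 896, 0, 1408, 0, 1664,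
  0, 0, 131, 832, 0, 1344, 0, 0, 259, 704, 0, 0, 0, 44, 19, 35, 67, 896, 448, 0, 0, 1408, 0, 1664,
  0, 1792, 0, 0, 131, 832, 0, 1344, 0, 1600, 0, 0, 259, 704, 0, 1216, 0, 0, 515, 448, 0, 0, 0, 67,
  896, 0, 1408, 0, 1664, 0, 0, 131, 832, 0, 1344, 0, 0, 259, 704, 0, 0, 0, 35, 67, 896, 0, 1408,
  0, 1664, 0, 0, 131, 832, 0, 1344, 0, 0, 259, 704, 0, 0, 0, 67, 896, 0, 1408, 0, 0, 131, 832, 0,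
  0, 0, 19, 112, 176, 1792, 0, 0, 304, 0, 560, 0, 1072, 0, 0, 176, 304, 0, 560, 0, 1072, 0, 0,
  304, 560, 0, 1072, 0, 0, 560, 1072, 0, 0, 1072, 0, 35, 67, 49, 0, 50, 0, 896, 0, 1408, 0, 1664,
  0, 0, 131, 49, 0, 50, 0, 832, 0, 1344, 0, 0, 259, 49, 0, 50, 0, 704, 0, 0, 515, 49, 0, 50, 0, 0,
  1027, 49, 0, 0, 0, 67, 49, 0, 50, 0, 896, 0, 1408, 0, 0, 131, 49, 0, 50, 0, 832, 0, 0, 259, 49,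
  0, 50, 0, 0, 515, 49, 0, 0, 0, 35, 112, 176, 0, 304, 0, 560, 0, 0, 176, 304, 0, 560, 0, 0, 304,
  560, 0, 0, 560, 0, 1072, 0, 67, 49, 0, 50, 0, 896, 0, 1408, 0, 0, 131, 49, 0, 50, 0, 832, 0, 0,
  259, 49, 0, 50, 0, 0, 515, 49, 0, 0, 0, 49, 67, 131, 0, 259, 0, 0, 131, 259, 0, 0, 259, 0, 515,
  0, 1027, 0, 50, 112, 896, 0, 1408, 0, 1664, 0, 0, 176, 832, 0, 1344, 0, 0, 304, 704, 0, 0, 0,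
  112, 896, 0, 1408, 0, 0, 176, 832, 0, 0, 0, 50, 67, 131, 0, 0, 131, 0, 259, 0, 515, 0, 1027, 0,
  112, 896, 0, 1408, 0, 0, 176, 832, 0, 0, 0, 196, 776, 0, 1288, 0, 1544, 0, 324, 448, 0, 0, 580,
  0, 1092, 0, 388, 0, 644, 0, 1156, 0, 772, 0, 0, 324, 1544, 0, 648, 0, 1160, 0, 580, 0, 1092, 0,
  388, 0, 644, 0, 1156, 0, 772, 0, 0, 580, 1160, 0, 1288, 0, 392, 0, 1092, 0, 388, 0, 644, 0,
  1156, 0, 772, 0, 0, 1092, 392, 0, 648, 0, 776, 0, 388, 0, 644, 0, 1156, 0, 772, 0, 0, 388, 1544,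
  0, 584, 0, 1096, 0, 644, 0, 1156, 0, 772, 0, 0, 644, 1096, 0, 1288, 0, 328, 0, 1156, 0, 772, 0,
  0, 1156, 772, 0, 1284, 0, 1540, 0, 328, 0, 0, 772, 1284, 0, 1540, 0, 200, 0, 0, 1284, 1540, 0,
  200, 0, 0, 1540, 200, 0, 0, 200, 776, 0, 1288, 0, 1544, 0, 1792, 0, 328, 0, 584, 0, 0, 328, 648,
  0, 1160, 0, 1544, 0, 584, 0, 1096, 0, 0, 584, 392, 0, 1160, 0, 1288, 0, 1096, 0, 0, 1096, 392,
  0, 648, 0, 776, 0, 0, 392, 1544, 0, 648, 0, 0, 648, 1288, 0, 0, 1160, 0, 776, 0, 1288, 0, 1544,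
  0, 67, 448, 1600, 0, 112, 0, 0, 704, 1344, 0, 0, 1216, 0, 832, 0, 1344, 0, 1600, 0, 0, 131, 448,
  1664, 0, 0, 704, 0, 1216, 0, 896, 0, 1408, 0, 0, 259, 448, 0, 832, 0, 1344, 0, 896, 0, 0, 515,
  704, 0, 832, 0, 1600, 0, 0, 1027, 1216, 0, 1344, 0, 0, 112, 896, 0, 0, 0]

def cert_0_1_6 : List ℕ := [
  25, 41, 0, 49, 0, 896, 0, 1408, 0, 1664, 0, 1792, 0, 0, 41, 49, 0, 896, 0, 1408, 0, 1664, 0,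
  1792, 0, 0, 49, 131, 1792, 0, 0, 259, 0, 515, 0, 1027, 0, 0, 26, 42, 0, 50, 0, 896, 0, 1408, 0,
  1664, 0, 0, 42, 50, 0, 896, 0, 1408, 0, 1664, 0, 0, 50, 131, 0, 259, 0, 515, 0, 0, 28, 88, 152,
  0, 280, 0, 0, 152, 280, 0, 0, 280, 0, 536, 0, 1048, 0, 896, 448, 0, 704, 0, 0, 1408, 448, 0, 0,
  1664, 0, 1792, 0, 19, 35, 131, 448, 0, 0, 0, 0, 0, 44, 104, 168, 0, 296, 0, 0, 168, 296, 0, 0,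
  296, 0, 552, 0, 1064, 0, 896, 448, 0, 0, 1408, 0, 1664, 0, 1792, 0, 0, 88, 152, 280, 0, 0, 280,
  0, 536, 0, 1048, 0, 896, 388, 0, 644, 0, 0, 1408, 388, 0, 0, 1664, 0, 1792, 0, 19, 35, 131, 388,
  0, 0, 0, 0, 0, 104, 168, 296, 0, 0, 296, 0, 552, 0, 1064, 0, 896, 388, 0, 0, 1408, 0, 1664, 0,
  1792, 0, 0, 388, 1540, 0, 1600, 0, 1544, 0, 52, 644, 0, 0, 392, 0, 644, 1284, 0, 1156, 0, 196,
  0, 0, 1156, 772, 0, 196, 0, 0, 772, 1284, 0, 0, 1284, 0, 112, 0, 896, 0, 1408, 0, 560, 0, 1072,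
  0, 0, 644, 1284, 0, 1344, 0, 1288, 0, 52, 0, 648, 0, 1156, 772, 0, 196, 0, 0, 772, 1540, 0, 0,
  1540, 0, 112, 0, 896, 0, 1664, 0, 304, 0, 1072, 0, 0, 1156, 772, 0, 832, 0, 52, 0, 776, 0, 1160,
  0, 1284, 1540, 0, 0, 1540, 0, 112, 0, 1408, 0, 1664, 0, 304, 0, 560, 0, 0, 772, 1216, 0, 52, 0,
  1160, 0, 776, 0, 1284, 324, 0, 0, 1540, 0, 112, 0, 896, 0, 1792, 0, 176, 0, 1072, 0, 0, 1284,
  704, 0, 52, 0, 648, 0, 1540, 0, 1288, 0, 112, 0, 1408, 0, 1792, 0, 176, 0, 560, 0, 0, 1540, 52,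
  0, 448, 0, 392, 0, 1544, 0, 112, 0, 1664, 0, 1792, 0, 176, 0, 304, 0, 0, 896, 1092, 0, 392, 0,
  648, 0, 776, 0, 1048, 0, 1064, 0, 176, 0, 304, 0, 560, 0, 448, 0, 704, 0, 0, 1408, 580, 0, 392,
  0, 1072, 0, 176, 0, 304, 0, 1160, 0, 1288, 0, 536, 0, 552, 0, 448, 0, 0, 1664, 176, 0, 560, 0,
  1072, 0, 324, 0, 648, 0, 1160, 0, 1544, 0, 1792, 0, 52, 0, 0, 1792, 304, 0, 560, 0, 1072, 0,
  196, 0, 776, 0, 1288, 0, 1544, 0, 52, 0, 0, 176, 776, 0, 1288, 0, 1544, 0, 52, 304, 0, 0, 112,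
  0, 304, 0, 560, 0, 1072, 0, 324, 0, 0, 304, 1544, 0, 648, 0, 1160, 0, 52, 0, 112, 0, 560, 0,
  1072, 0, 196, 0, 0, 560, 1160, 0, 1288, 0, 392, 0, 52, 0, 112, 0, 1072, 0, 196, 0, 0, 1072, 392,
  0, 648, 0, 776, 0, 52, 0, 112, 0, 196, 0, 0, 52, 392, 0, 648, 0, 1160, 0, 776, 0, 1288, 0, 1544,
  0, 0, 112, 19, 0, 35, 0, 131, 0, 259, 0, 515, 0, 0, 392, 448, 0, 1600, 0, 515, 0, 1027, 0, 580,
  0, 1092, 0, 0, 648, 704, 0, 1344, 0, 1027, 0, 1092, 0, 259, 0, 0, 1160, 1216, 0, 832, 0, 259, 0,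
  515, 0, 0, 776, 832, 0, 1216, 0, 1027, 0, 0, 1288, 1344, 0, 704, 0, 0, 1544, 1600, 0, 0, 448,
  1600, 0, 704, 0, 1216, 0, 832, 0, 0, 704, 1344, 0, 1216, 0, 832, 0, 0, 1216, 832, 0, 1344, 0, 0,
  832, 1344, 0, 0, 1344, 0, 1600, 0, 196, 324, 0, 580, 0, 0, 324, 580, 0, 0, 580, 0, 1092, 0, 0]

def cert_4_5_6 : List ℕ := [
  392, 1540, 0, 1600, 0, 388, 0, 1544, 0, 448, 0, 67, 0, 515, 0, 1027, 0, 0, 648, 1284, 0, 1344,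
  0, 1288, 0, 13, 0, 14, 0, 88, 0, 104, 0, 0, 1160, 772, 0, 832, 0, 776, 0, 13, 0, 14, 0, 88, 0,
  0, 776, 1156, 0, 1216, 0, 13, 0, 14, 0, 88, 0, 0, 1288, 644, 0, 704, 0, 13, 0, 14, 0, 0, 1544,
  13, 0, 14, 0, 88, 0, 0, 13, 88, 0, 104, 0, 896, 448, 0, 704, 0, 0, 1408, 448, 0, 0, 1664, 0,
  1792, 0, 49, 14, 50, 52, 176, 448, 0, 0, 0, 0, 0, 0, 0, 14, 88, 0, 104, 0, 896, 448, 0, 0, 1408,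
  0, 1664, 0, 1792, 0, 0, 88, 896, 388, 0, 644, 0, 0, 1408, 388, 0, 0, 1664, 0, 1792, 0, 19, 35,
  67, 131, 388, 0, 0, 0, 0, 0, 0, 104, 896, 388, 0, 0, 1408, 0, 1664, 0, 1792, 0, 0, 388, 1600, 0,
  1540, 0, 448, 0, 52, 0, 644, 0, 1156, 0, 0, 644, 1344, 0, 1284, 0, 704, 0, 52, 0, 1156, 0, 0,
  1156, 772, 0, 832, 0, 1216, 0, 52, 0, 0, 772, 1216, 0, 832, 0, 52, 0, 0, 1284, 704, 0, 1344, 0,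
  0, 1540, 448, 0, 0, 19, 176, 1792, 0, 0, 304, 0, 560, 0, 1072, 0, 0, 35, 176, 0, 304, 0, 560, 0,
  0, 448, 1600, 0, 67, 0, 515, 0, 1027, 0, 0, 704, 1344, 0, 67, 0, 1027, 0, 0, 1216, 832, 0, 67,
  0, 0, 832, 67, 0, 0, 1344, 0, 1600, 0, 67, 131, 896, 0, 1408, 0, 0, 259, 896, 0, 0, 0, 131, 896,
  0, 0, 0]

def cert_2_6_7 : List ℕ := [
  772, 200, 0, 776, 0, 1216, 0, 1792, 0, 1048, 0, 1064, 0, 0, 1284, 200, 0, 1792, 0, 1288, 0, 704,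
  0, 52, 0, 0, 1540, 200, 0, 1792, 0, 1544, 0, 448, 0, 0, 776, 52, 0, 1072, 0, 1792, 0, 1092, 0,
  1156, 0, 0, 1288, 52, 0, 1792, 0, 560, 0, 580, 0, 0, 1544, 52, 0, 1792, 0, 304, 0, 0, 1792, 304,
  0, 560, 0, 0, 52, 200, 0, 324, 0, 580, 0, 0, 200, 280, 0, 536, 0, 0, 304, 448, 0, 560, 0, 1072,
  0, 704, 0, 1216, 0, 0, 560, 704, 0, 1072, 0, 448, 0, 1216, 0, 0, 1072, 1216, 0, 448, 0, 704, 0,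
  0, 448, 704, 0, 1216, 0, 0, 704, 1216, 0, 0, 1216, 0, 324, 644, 0, 1156, 0, 580, 0, 0, 580, 388,
  0, 1156, 0, 0, 1092, 388, 0, 0, 388, 0, 644, 0, 0]

def cert_6_7_8 : List ℕ := [
  25, 515, 0, 1027, 0, 536, 0, 1048, 0, 19, 41, 0, 49, 0, 0, 35, 41, 0, 0, 41, 0, 49, 0, 0, 41,
  515, 0, 1027, 0, 552, 0, 1064, 0, 19, 49, 0, 0, 35, 0, 49, 0, 0, 26, 515, 0, 1027, 0, 536, 0,
  1048, 0, 19, 28, 0, 0, 35, 0, 28, 0, 0, 42, 515, 0, 1027, 0, 552, 0, 1064, 0, 19, 0, 35, 0, 0,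
  1540, 196, 0, 324, 0, 388, 0, 19, 0, 35, 0, 1600, 0, 1664, 0, 1792, 0, 0, 200, 1792, 0, 52, 0,
  1544, 0, 304, 0, 259, 0, 515, 0, 1027, 0, 0, 328, 1664, 0, 52, 0, 1544, 0, 392, 0, 515, 0, 1027,
  0, 0, 392, 1600, 0, 52, 0, 1544, 0, 515, 0, 1027, 0, 0, 1544, 112, 0, 176, 0, 304, 0, 1600, 0,
  1664, 0, 1792, 0, 0, 196, 1792, 0, 304, 0, 52, 0, 704, 0, 1216, 0, 560, 0, 1072, 0, 0, 324,
  1664, 0, 176, 0, 52, 0, 832, 0, 1344, 0, 560, 0, 0, 388, 1600, 0, 52, 0, 112, 0, 536, 0, 1048,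
  0, 0, 536, 1064, 0, 13, 0, 14, 0, 1048, 0, 0, 1048, 552, 0, 13, 0, 14, 0, 0, 552, 13, 0, 14, 0,
  0, 1064, 13, 0, 0, 67, 1600, 0, 112, 0, 560, 0, 1072, 0, 896, 0, 1408, 0, 0, 131, 1664, 0, 176,
  0, 560, 0, 1072, 0, 832, 0, 0, 259, 1792, 0, 304, 0, 560, 0, 1072, 0, 0, 28, 515, 0, 1027, 0,
  19, 0, 35, 0, 0, 44, 515, 0, 1027, 0, 19, 0, 0, 1600, 112, 0, 19, 0, 35, 0, 0, 1664, 176, 0, 19,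
  0, 0, 1792, 304, 0, 0, 19, 560, 0, 0, 35, 0, 515, 704, 0, 832, 0, 0, 1027, 1216, 0, 0, 13, 49,
  14, 50, 52, 112, 896, 0, 1408, 0, 0, 176, 832, 0, 0, 0, 112, 896, 0, 0, 0, 52, 112, 896, 0, 0,
  0, 0, 50, 52, 112, 896, 0, 0, 0, 0, 0, 14, 50, 52, 112, 896, 0, 0, 0, 0, 0, 0, 49, 14, 50, 52,
  112, 896, 0, 0, 0, 0, 0, 0, 0]

theorem run_0_1_4 : force [7, 11, 56, 19] cert_0_1_4 [] allc = true := by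
  decide +kernel

theorem run_0_1_5 : force [7, 11, 56, 35] cert_0_1_5 [] allc = true := by
  decide +kernel

theorem run_0_3_4 : force [7, 11, 56, 25] cert_0_3_4 [] allc = true := by
  decide +kernel

theorem run_0_3_5 : force [7, 11, 56, 41] cert_0_3_5 [] allc = true := by
  decide +kernel

theorem run_0_4_5 : force [7, 11, 56, 49] cert_0_4_5 [] allc = true := by
  decide +kernel

theorem run_1_3_4 : force [7, 11, 56, 26] cert_1_3_4 [] allc = true := by
  decide +kernel

theorem run_1_3_5 : force [7, 11, 56, 42] cert_1_3_5 [] allc = true := by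
  decide +kernel

theorem run_1_4_5 : force [7, 11, 56, 50] cert_1_4_5 [] allc = true := by
  decide +kernel

theorem run_2_3_4 : force [7, 11, 56, 28] cert_2_3_4 [] allc = true := by
  decide +kernel

theorem run_2_3_5 : force [7, 11, 56, 44] cert_2_3_5 [] allc = true := by
  decide +kernel

theorem run_2_4_5 : force [7, 11, 56, 52] cert_2_4_5 [] allc = true := by
  decide +kernel

theorem run_0_1_6 : force [7, 11, 56, 67] cert_0_1_6 [] allc = true := by
  decide +kernel

theorem run_4_5_6 : force [7, 11, 56, 112] cert_4_5_6 [] allc = true := by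
  decide +kernel

theorem run_2_6_7 : force [7, 11, 56, 196] cert_2_6_7 [] allc = true := by
  decide +kernel

theorem run_6_7_8 : force [7, 11, 56, 448] cert_6_7_8 [] allc = true := by
  decide +kernel

theorem mem_filt {X : ℕ → Prop}
    (hbad : ∀ e g h, X e → X g → X h → bad (e &&& g) e g h = false) {e m : ℕ}
    (he : X e) (hm : X m) :
    ∀ ch ca : List ℕ, (∀ c ∈ ch, X c) → m ∈ ca → m ∈ filt e ch ca := by
  intro ch
  induction ch with
  | nil => intro ca _ h; exact h
  | cons g ch ih =>
    intro ca hch hca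
    have hg : X g := hch g (by simp)
    have hch' : ∀ c ∈ ch, X c := fun c hc => hch c (by simp [hc])
    unfold filt
    cases (Nat.beq (e &&& g) 0 || one (e &&& g))
    · exact ih _ hch' hca
    · refine ih _ hch' ?_
      rw [List.mem_filter]
      exact ⟨hca, by simp [hbad e g m he hg hm]⟩

theorem srch_sound {X : ℕ → Prop}
    (hbad : ∀ e g h, X e → X g → X h → bad (e &&& g) e g h = false) :
    ∀ (n : ℕ) (t ch ca s : List ℕ), srch n t ch ca = some s → (∀ c ∈ ch, X c) →
      ∀ F : Finset ℕ, (∀ m ∈ F, X m ∧ (m ∈ ch ∨ m ∈ ca)) → F.card ≤ 18 := by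
  intro n
  induction n with
  | zero => intro t ch ca s h; simp [srch] at h
  | succ n ih =>
    intro t ch ca s h hch F hF
    cases t with
    | nil => simp [srch] at h
    | cons e t =>
      unfold srch at h
      by_cases he0 : Nat.beq e 0 = true
      · rw [he0, cond_true] at h
        by_cases hl : Nat.ble (ch.length + ca.length) 18 = true
        · have hl' := Nat.le_of_ble_eq_true hl
          have hsub : F ⊆ (ch ++ ca).toFinset := by
            intro m hm
            have := (hF m hm).2
            simpa using this
          calc F.card ≤ (ch ++ ca).toFinset.card := Finset.card_le_card hsub
            _ ≤ (ch ++ ca).length := List.toFinset_card_le _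
            _ ≤ 18 := by simpa using hl'
        · rw [Bool.not_eq_true] at hl
          rw [hl] at h; simp at h
      · rw [Bool.not_eq_true] at he0
        rw [he0, cond_false] at h
        have key : ∀ m, X m → m ∈ ca → m = e ∨ m ∈ ca.filter (fun h => !(Nat.beq h e)) := by
          intro m _ hmc
          by_cases hme : m = e
          · exact Or.inl hme
          · right
            rw [List.mem_filter]
            refine ⟨hmc, ?_⟩
            rw [Bool.not_eq_true', ← Bool.not_eq_true, Nat.beq_eq]
            exact hme
        split at h
        · simp at h
        · rename_i t' ht'
          by_cases hX : X e
          · refine ih _ _ _ _ ht' ?_ F ?_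
            · intro c hc
              rcases List.mem_cons.1 hc with rfl | hc
              · exact hX
              · exact hch c hc
            · intro m hm
              obtain ⟨hm1, hm2⟩ := hF m hm
              refine ⟨hm1, ?_⟩
              rcases hm2 with hm2 | hm2
              · left; exact List.mem_cons_of_mem _ hm2
              · rcases key m hm1 hm2 with rfl | hk
                · left; simp
                · right; exact mem_filt hbad hX hm1 _ _ hch hk
          · refine ih _ _ _ _ h hch F ?_
            intro m hm
            obtain ⟨hm1, hm2⟩ := hF m hm
            refine ⟨hm1, ?_⟩
            rcases hm2 with hm2 | hm2
            · exact Or.inl hm2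
            · rcases key m hm1 hm2 with rfl | hk
              · exact absurd hm1 hX
              · exact Or.inr hk

theorem force_sound {X : ℕ → Prop}
    (hbad : ∀ e g h, X e → X g → X h → bad (e &&& g) e g h = false) :
    ∀ (fs t ch ca : List ℕ), force fs t ch ca = true → (∀ c ∈ fs, X c) → (∀ c ∈ ch, X c) →
      ∀ F : Finset ℕ, (∀ m ∈ F, X m ∧ (m ∈ ch ∨ m ∈ ca)) → F.card ≤ 18 := by
  intro fs
  induction fs with
  | nil =>
    intro t ch ca h _ hch F hF
    unfold force at h
    obtain ⟨s, hs⟩ := Option.isSome_iff_exists.1 h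
    exact srch_sound hbad _ _ _ _ _ hs hch F hF
  | cons e fs ih =>
    intro t ch ca h hfs hch F hF
    unfold force at h
    have hX : X e := hfs e (by simp)
    refine ih _ _ _ h (fun c hc => hfs c (by simp [hc])) ?_ F ?_
    · intro c hc
      rcases List.mem_cons.1 hc with rfl | hc
      · exact hX
      · exact hch c hc
    · intro m hm
      obtain ⟨hm1, hm2⟩ := hF m hm
      refine ⟨hm1, ?_⟩
      rcases hm2 with hm2 | hm2
      · left; exact List.mem_cons_of_mem _ hm2
      · by_cases hme : m = e
        · left; simp [hme]
        · right
          refine mem_filt hbad hX hm1 _ _ hch ?_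
          rw [List.mem_filter]
          refine ⟨hm2, ?_⟩
          rw [Bool.not_eq_true', ← Bool.not_eq_true, Nat.beq_eq]
          exact hme

/-! ### Finding paths and triangles -/

theorem card_three_split {e : Finset ℕ} {p q : ℕ} (he : e.card = 3) (hp : p ∈ e) (hq : q ∈ e)
    (hpq : p ≠ q) : ∃ r, r ≠ p ∧ r ≠ q ∧ e = {p, q, r} := by
  have h1 : (e \ {p, q}).card = 1 := by
    rw [Finset.card_sdiff_of_subset (by intro v; simp; rintro (rfl | rfl) <;> assumption)]
    rw [he, Finset.card_pair hpq]
  obtain ⟨r, hr⟩ := Finset.card_eq_one.1 h1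
  have hr' : r ∈ e \ {p, q} := by rw [hr]; simp
  simp only [Finset.mem_sdiff, Finset.mem_insert, Finset.mem_singleton, not_or] at hr'
  refine ⟨r, hr'.2.1, hr'.2.2, ?_⟩
  ext v
  have : v ∈ e \ {p, q} ↔ v ∈ ({r} : Finset ℕ) := by rw [hr]
  simp only [Finset.mem_sdiff, Finset.mem_insert, Finset.mem_singleton, not_or] at this ⊢
  constructor
  · intro hv
    by_cases h1 : v = p
    · exact Or.inl h1
    · by_cases h2 : v = q
      · exact Or.inr (Or.inl h2)
      · exact Or.inr (Or.inr (this.1 ⟨hv, h1, h2⟩))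
  · rintro (rfl | rfl | rfl)
    · exact hp
    · exact hq
    · exact hr'.1

theorem card_three_split_one {e : Finset ℕ} {p : ℕ} (he : e.card = 3) (hp : p ∈ e) :
    ∃ q r, q ≠ p ∧ r ≠ p ∧ r ≠ q ∧ e = {p, q, r} := by
  obtain ⟨q, hq, hqp⟩ := Finset.exists_mem_ne (by omega : 1 < e.card) p
  obtain ⟨r, h1, h2, h3⟩ := card_three_split he hp hq hqp.symm
  exact ⟨q, r, hqp, h1, h2, h3⟩

theorem path_of {H : ThreeGraph} (hv : H.IsValid) (hP : H.Free pathP) {e f g : Finset ℕ}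
    (he : e ∈ H.edges) (hf : f ∈ H.edges) (hg : g ∈ H.edges)
    (h1 : (e ∩ f).card = 1) (h2 : (f ∩ g).card = 1) (h3 : e ∩ g = ∅) : False := by
  obtain ⟨p, hp⟩ := Finset.card_eq_one.1 h1
  obtain ⟨q, hq⟩ := Finset.card_eq_one.1 h2
  have hpm : p ∈ e ∩ f := by simp [hp]
  have hqm : q ∈ f ∩ g := by simp [hq]
  rw [Finset.mem_inter] at hpm hqm
  have hd : ∀ v, v ∈ e → v ∈ g → False := by
    intro v h h'
    have : v ∈ e ∩ g := Finset.mem_inter.2 ⟨h, h'⟩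
    rw [h3] at this; simp at this
  have hef : ∀ v, v ∈ e → v ∈ f → v = p := by
    intro v h h'
    have : v ∈ e ∩ f := Finset.mem_inter.2 ⟨h, h'⟩
    rw [hp] at this; simpa using this
  have hfg : ∀ v, v ∈ f → v ∈ g → v = q := by
    intro v h h'
    have : v ∈ f ∩ g := Finset.mem_inter.2 ⟨h, h'⟩
    rw [hq] at this; simpa using this
  have hpq : p ≠ q := by rintro rfl; exact hd _ hpm.1 hqm.2
  obtain ⟨a, b, ha, hb, hba, hee⟩ := card_three_split_one (hv e he).1 hpm.1
  obtain ⟨r, hr1, hr2, hff⟩ := card_three_split (hv f hf).1 hpm.2 hqm.1 hpq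
  obtain ⟨c, d, hc, hd', hdc, hgg⟩ := card_three_split_one (hv g hg).1 hqm.2
  have sub : ∀ x ∈ H.edges, ∀ v ∈ x, v ∈ H.verts := fun x hx v hvx => (hv x hx).2 hvx
  have ea : a ∈ e := by simp [hee]
  have eb : b ∈ e := by simp [hee]
  have fr : r ∈ f := by simp [hff]
  have gc : c ∈ g := by simp [hgg]
  have gd : d ∈ g := by simp [hgg]
  apply hP
  refine ⟨fun i => [a, b, p, r, q, c, d].getD i 0, ?_, ?_, ?_⟩
  · have hnd : [a, b, p, r, q, c, d].Nodup := by
      simp only [List.nodup_cons, List.mem_cons, List.not_mem_nil, or_false, not_or,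
        List.nodup_nil, and_true, not_false_eq_true]
      grind
    intro i hi j hj hij
    have hi' : i < 7 := by simp [pathP] at hi; omega
    have hj' : j < 7 := by simp [pathP] at hj; omega
    simp only at hij
    rw [List.getD_eq_getElem _ _ (by simpa using hi'),
      List.getD_eq_getElem _ _ (by simpa using hj')] at hij
    exact (List.Nodup.getElem_inj_iff hnd).1 hij
  · intro v hvv
    simp only [pathP, Finset.mem_insert, Finset.mem_singleton] at hvv
    rcases hvv with rfl | rfl | rfl | rfl | rfl | rfl | rfl
    · exact sub e he _ ea
    · exact sub e he _ eb
    · exact sub e he _ hpm.1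
    · exact sub f hf _ fr
    · exact sub f hf _ hqm.1
    · exact sub g hg _ gc
    · exact sub g hg _ gd
  · intro x hx
    simp only [pathP, Finset.mem_insert, Finset.mem_singleton] at hx
    rcases hx with rfl | rfl | rfl
    · convert he using 1
      rw [hee]; ext v; simp; tauto
    · convert hf using 1
      rw [hff]; ext v; simp; tauto
    · convert hg using 1
      rw [hgg]; ext v; simp

theorem tri_of {H : ThreeGraph} (hv : H.IsValid) (hC : H.Free triangleC) {e f g : Finset ℕ}
    (he : e ∈ H.edges) (hf : f ∈ H.edges) (hg : g ∈ H.edges)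
    (h1 : (e ∩ f).card = 1) (h2 : (f ∩ g).card = 1) (h3 : (e ∩ g).card = 1)
    (h4 : e ∩ f ≠ e ∩ g) : False := by
  obtain ⟨p, hp⟩ := Finset.card_eq_one.1 h1
  obtain ⟨q, hq⟩ := Finset.card_eq_one.1 h2
  obtain ⟨s, hs⟩ := Finset.card_eq_one.1 h3
  have hpm : p ∈ e ∩ f := by simp [hp]
  have hqm : q ∈ f ∩ g := by simp [hq]
  have hsm : s ∈ e ∩ g := by simp [hs]
  rw [Finset.mem_inter] at hpm hqm hsm
  have hps : p ≠ s := by rintro rfl; exact h4 (hp.trans hs.symm)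
  have hef : ∀ v, v ∈ e → v ∈ f → v = p := by
    intro v h h'
    have : v ∈ e ∩ f := Finset.mem_inter.2 ⟨h, h'⟩
    rw [hp] at this; simpa using this
  have hfg : ∀ v, v ∈ f → v ∈ g → v = q := by
    intro v h h'
    have : v ∈ f ∩ g := Finset.mem_inter.2 ⟨h, h'⟩
    rw [hq] at this; simpa using this
  have heg : ∀ v, v ∈ e → v ∈ g → v = s := by
    intro v h h'
    have : v ∈ e ∩ g := Finset.mem_inter.2 ⟨h, h'⟩
    rw [hs] at this; simpa using this
  have hpq : p ≠ q := by rintro rfl; exact hps (heg _ hpm.1 hqm.2)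
  have hqs : q ≠ s := by rintro rfl; exact hpq (hef _ hsm.1 hqm.1).symm
  obtain ⟨a, ha1, ha2, hee⟩ := card_three_split (hv e he).1 hsm.1 hpm.1 hps.symm
  obtain ⟨b, hb1, hb2, hff⟩ := card_three_split (hv f hf).1 hpm.2 hqm.1 hpq
  obtain ⟨c, hc1, hc2, hgg⟩ := card_three_split (hv g hg).1 hqm.2 hsm.2 hqs
  have sub : ∀ x ∈ H.edges, ∀ v ∈ x, v ∈ H.verts := fun x hx v hvx => (hv x hx).2 hvx
  have ea : a ∈ e := by simp [hee]
  have fb : b ∈ f := by simp [hff]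
  have gc : c ∈ g := by simp [hgg]
  apply hC
  refine ⟨fun i => [s, a, p, b, q, c].getD i 0, ?_, ?_, ?_⟩
  · have hnd : [s, a, p, b, q, c].Nodup := by
      simp only [List.nodup_cons, List.mem_cons, List.not_mem_nil, or_false, not_or,
        List.nodup_nil, and_true, not_false_eq_true]
      grind
    intro i hi j hj hij
    have hi' : i < 6 := by simp [triangleC] at hi; omega
    have hj' : j < 6 := by simp [triangleC] at hj; omega
    simp only at hij
    rw [List.getD_eq_getElem _ _ (by simpa using hi'),
      List.getD_eq_getElem _ _ (by simpa using hj')] at hij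
    exact (List.Nodup.getElem_inj_iff hnd).1 hij
  · intro v hvv
    simp only [triangleC, Finset.mem_insert, Finset.mem_singleton] at hvv
    rcases hvv with rfl | rfl | rfl | rfl | rfl | rfl
    · exact sub e he _ hsm.1
    · exact sub e he _ ea
    · exact sub e he _ hpm.1
    · exact sub f hf _ fb
    · exact sub f hf _ hqm.1
    · exact sub g hg _ gc
  · intro x hx
    simp only [triangleC, Finset.mem_insert, Finset.mem_singleton] at hx
    rcases hx with rfl | rfl | rfl
    · convert he using 1
      rw [hee]; ext v; simp; tauto
    · convert hf using 1
      rw [hff]; ext v; simp; tauto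
    · convert hg using 1
      rw [hgg]; ext v; simp; tauto

/-! ### Masks and labellings -/

/-- The set of labels of a mask. -/
def bits (m : ℕ) : Finset ℕ := (Finset.range 11).filter fun i => m.testBit i = true

/-- The mask of a set of labels. -/
def mask (s : Finset ℕ) : ℕ := ∑ i ∈ s, 2 ^ i

theorem bits_land (p q : ℕ) : bits (p &&& q) = bits p ∩ bits q := by
  ext i
  simp [bits]
  tauto

theorem one_card : ∀ m < 2048, one m = true → (bits m).card = 1 := by
  decide +kernel

theorem bits_zero {m : ℕ} (h : Nat.beq m 0 = true) : bits m = ∅ := by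
  rw [Nat.beq_eq] at h
  subst h
  simp [bits]

theorem mask_spec : ∀ s ∈ (Finset.range 11).powersetCard 3,
    mask s ∈ allc ∧ mask s < 2048 ∧ bits (mask s) = s := by
  decide +kernel

/-- The labelled edge predicate. -/
def IsE (H : ThreeGraph) (φ : ℕ → ℕ) (m : ℕ) : Prop :=
  m < 2048 ∧ (bits m).image φ ∈ H.edges

section
variable {H : ThreeGraph} {φ : ℕ → ℕ}

theorem image_bits_land (hφ : Set.InjOn φ (Finset.range 11 : Finset ℕ)) (p q : ℕ) :
    (bits p).image φ ∩ (bits q).image φ = (bits (p &&& q)).image φ := by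
  rw [bits_land, Finset.image_inter_of_injOn]
  refine hφ.mono ?_
  intro i hi
  simp only [bits, Finset.coe_filter, Set.mem_union, Set.mem_ofPred_eq] at hi
  rcases hi with hi | hi <;> exact Finset.mem_coe.2 hi.1

theorem card_image_bits (hφ : Set.InjOn φ (Finset.range 11 : Finset ℕ)) (m : ℕ) :
    ((bits m).image φ).card = (bits m).card := by
  apply Finset.card_image_of_injOn
  refine hφ.mono ?_
  intro i hi
  simp only [bits, Finset.coe_filter, Set.mem_ofPred_eq] at hi
  exact Finset.mem_coe.2 hi.1

theorem land_lt {p q : ℕ} (hp : p < 2048) : p &&& q < 2048 :=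
  lt_of_le_of_lt Nat.and_le_left hp

theorem isE_bad (hv : H.IsValid) (hP : H.Free pathP) (hC : H.Free triangleC)
    (hφ : Set.InjOn φ (Finset.range 11 : Finset ℕ)) (e g h : ℕ)
    (he : IsE H φ e) (hg : IsE H φ g) (hh : IsE H φ h) : bad (e &&& g) e g h = false := by
  rw [← Bool.not_eq_true]
  intro hb
  obtain ⟨he1, he2⟩ := he
  obtain ⟨hg1, hg2⟩ := hg
  obtain ⟨hh1, hh2⟩ := hh
  have c1 : ∀ {p q : ℕ}, p < 2048 → one (p &&& q) = true →
      ((bits p).image φ ∩ (bits q).image φ).card = 1 := by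
    intro p q hp h1
    rw [image_bits_land hφ, card_image_bits hφ]
    exact one_card _ (land_lt hp) h1
  have c0 : ∀ {p q : ℕ}, Nat.beq (p &&& q) 0 = true →
      (bits p).image φ ∩ (bits q).image φ = ∅ := by
    intro p q h1
    rw [image_bits_land hφ, bits_zero h1, Finset.image_empty]
  have sw : ∀ {p q : ℕ}, ((bits p).image φ ∩ (bits q).image φ).card = 1 →
      ((bits q).image φ ∩ (bits p).image φ).card = 1 := by
    intro p q h1; rwa [Finset.inter_comm]
  unfold bad at hb
  by_cases h0 : Nat.beq (e &&& g) 0 = true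
  · rw [h0, cond_true, Bool.and_eq_true] at hb
    exact path_of hv hP he2 hh2 hg2 (c1 he1 hb.1) (sw (c1 hg1 hb.2)) (c0 h0)
  · rw [Bool.not_eq_true] at h0
    rw [h0, cond_false, Bool.and_eq_true] at hb
    obtain ⟨ha, hb⟩ := hb
    by_cases h1 : one (e &&& h) = true
    · rw [h1, cond_true, Bool.or_eq_true, Bool.and_eq_true] at hb
      rcases hb with hb | ⟨hb, hne⟩
      · exact path_of hv hP hg2 he2 hh2 (sw (c1 he1 ha)) (c1 he1 h1) (c0 hb)
      · refine tri_of hv hC he2 hg2 hh2 (c1 he1 ha) (c1 hg1 hb) (c1 he1 h1) ?_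
        rw [Bool.not_eq_true', ← Bool.not_eq_true, Nat.beq_eq] at hne
        intro heq
        apply hne
        rw [image_bits_land hφ, image_bits_land hφ] at heq
        have hsub : ∀ m, bits m ⊆ Finset.range 11 := fun m => Finset.filter_subset _ _
        have heq2 : bits (e &&& g) = bits (e &&& h) := by
          ext i
          constructor
          · intro hi
            have : φ i ∈ (bits (e &&& h)).image φ := by
              rw [← heq]; exact Finset.mem_image_of_mem _ hi
            obtain ⟨j, hj, hji⟩ := Finset.mem_image.1 this
            rwa [← hφ (Finset.mem_coe.2 (hsub _ hj)) (Finset.mem_coe.2 (hsub _ hi)) hji]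
          · intro hi
            have : φ i ∈ (bits (e &&& g)).image φ := by
              rw [heq]; exact Finset.mem_image_of_mem _ hi
            obtain ⟨j, hj, hji⟩ := Finset.mem_image.1 this
            rwa [← hφ (Finset.mem_coe.2 (hsub _ hj)) (Finset.mem_coe.2 (hsub _ hi)) hji]
        apply Nat.eq_of_testBit_eq
        intro i
        by_cases hi : i < 11
        · have : i ∈ bits (e &&& g) ↔ i ∈ bits (e &&& h) := by rw [heq2]
          simp only [bits, Finset.mem_filter, Finset.mem_range, hi, true_and] at this
          exact Bool.eq_iff_iff.2 this
        · have hle : 2048 ≤ 2 ^ i := by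
            calc 2048 = 2 ^ 11 := by norm_num
              _ ≤ 2 ^ i := Nat.pow_le_pow_right (by norm_num) (by omega)
          rw [Nat.testBit_lt_two_pow (lt_of_lt_of_le (land_lt he1) hle),
            Nat.testBit_lt_two_pow (lt_of_lt_of_le (land_lt he1) hle)]
    · rw [Bool.not_eq_true] at h1
      rw [h1, cond_false, Bool.and_eq_true] at hb
      exact path_of hv hP he2 hg2 hh2 (c1 he1 ha) (c1 hg1 hb.2) (c0 hb.1)

/-- Every edge has a mask. -/
theorem exists_labels (hv : H.IsValid) (hφ : Set.InjOn φ (Finset.range 11 : Finset ℕ))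
    (himg : (Finset.range 11).image φ = H.verts) {e : Finset ℕ} (he : e ∈ H.edges) :
    ((Finset.range 11).filter fun i => φ i ∈ e) ∈ (Finset.range 11).powersetCard 3 ∧
    ((Finset.range 11).filter fun i => φ i ∈ e).image φ = e := by
  have h1 : ((Finset.range 11).filter fun i => φ i ∈ e).image φ = e := by
    ext v
    simp only [Finset.mem_image, Finset.mem_filter]
    constructor
    · rintro ⟨i, ⟨_, hi⟩, rfl⟩; exact hi
    · intro hve
      have : v ∈ (Finset.range 11).image φ := by rw [himg]; exact (hv e he).2 hve
      obtain ⟨i, hi, rfl⟩ := Finset.mem_image.1 this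
      exact ⟨i, ⟨hi, hve⟩, rfl⟩
  refine ⟨?_, h1⟩
  rw [Finset.mem_powersetCard]
  refine ⟨Finset.filter_subset _ _, ?_⟩
  rw [← (hv e he).1]
  conv_rhs => rw [← h1]
  symm
  apply Finset.card_image_of_injOn
  refine hφ.mono ?_
  intro i hi
  exact Finset.mem_coe.2 (Finset.mem_filter.1 (Finset.mem_coe.1 hi)).1

theorem bound (hv : H.IsValid) (hP : H.Free pathP) (hC : H.Free triangleC)
    (hφ : Set.InjOn φ (Finset.range 11 : Finset ℕ))
    (himg : (Finset.range 11).image φ = H.verts) {fs t : List ℕ}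
    (hrun : force fs t [] allc = true) (hfs : ∀ c ∈ fs, IsE H φ c) : H.edges.card ≤ 18 := by
  classical
  have hF := force_sound (isE_bad hv hP hC hφ) fs t [] allc hrun hfs (by simp)
    (allc.toFinset.filter fun m => IsE H φ m) (by
      intro m hm
      rw [Finset.mem_filter, List.mem_toFinset] at hm
      exact ⟨hm.2, Or.inr hm.1⟩)
  refine le_trans ?_ hF
  refine le_trans (Finset.card_le_card ?_)
    (Finset.card_image_le (f := fun m => (bits m).image φ))
  intro e he
  obtain ⟨h1, h2⟩ := exists_labels hv hφ himg he
  obtain ⟨h3, h4, h5⟩ := mask_spec _ h1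
  refine Finset.mem_image.2 ⟨_, Finset.mem_filter.2 ⟨List.mem_toFinset.2 h3, h4, ?_⟩, ?_⟩
  · rw [h5, h2]; exact he
  · simp only [h5, h2]

end

theorem exists_list {V : Finset ℕ} (hV : V.card = 11) {P : List ℕ} (hP : P.Nodup)
    (hPV : ∀ v ∈ P, v ∈ V) :
    ∃ L : List ℕ, L.Nodup ∧ L.length = 11 ∧ (∀ v, v ∈ L ↔ v ∈ V) ∧
      ∃ R, L = P ++ R ∧ ∀ v ∈ R, v ∉ P := by
  have hR : ∀ v ∈ (V \ P.toFinset).toList, v ∉ P := by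
    intro v hv
    simp at hv
    exact hv.2
  have hmem : ∀ v, v ∈ P ++ (V \ P.toFinset).toList ↔ v ∈ V := by
    intro v
    simp only [List.mem_append, Finset.mem_toList, Finset.mem_sdiff, List.mem_toFinset]
    constructor
    · rintro (h | h)
      · exact hPV v h
      · exact h.1
    · intro h
      by_cases hp : v ∈ P
      · exact Or.inl hp
      · exact Or.inr ⟨h, hp⟩
  have hnd : (P ++ (V \ P.toFinset).toList).Nodup := by
    rw [List.nodup_append]
    refine ⟨hP, Finset.nodup_toList _, ?_⟩
    intro a ha b hb hab
    subst hab
    exact hR _ hb ha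
  refine ⟨_, hnd, ?_, hmem, _, rfl, hR⟩
  rw [← List.toFinset_card_of_nodup hnd, ← hV]
  congr 1
  ext v
  rw [List.mem_toFinset, hmem]

theorem label_cases : ∀ s ∈ (Finset.range 11).powersetCard 3,
    (∀ i ∈ Finset.Ico 6 10, i + 1 ∈ s → i ∈ s) → ¬ s ⊆ {0, 1, 2, 3} →
    ¬ (3 ∈ s ∧ 0 ∉ s ∧ 1 ∉ s ∧ 2 ∉ s) →
    mask s ∈ [19, 35, 25, 41, 49, 26, 42, 50, 28, 44, 52, 67, 112, 196, 448] ∨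
      (bad (7 &&& 11) 7 11 (mask s) || bad (7 &&& 56) 7 56 (mask s) ||
        bad (11 &&& 56) 11 56 (mask s)) = true := by
  decide +kernel

theorem run_all : ∀ m ∈ [19, 35, 25, 41, 49, 26, 42, 50, 28, 44, 52, 67, 112, 196, 448], ∃ t, force [7, 11, 56, m] t [] allc = true := by
  intro m hm
  simp only [List.mem_cons, List.not_mem_nil, or_false] at hm
  rcases hm with rfl | rfl | rfl | rfl | rfl | rfl | rfl | rfl | rfl | rfl | rfl | rfl | rfl | rfl | rfl
  · exact ⟨_, run_0_1_4⟩
  · exact ⟨_, run_0_1_5⟩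
  · exact ⟨_, run_0_3_4⟩
  · exact ⟨_, run_0_3_5⟩
  · exact ⟨_, run_0_4_5⟩
  · exact ⟨_, run_1_3_4⟩
  · exact ⟨_, run_1_3_5⟩
  · exact ⟨_, run_1_4_5⟩
  · exact ⟨_, run_2_3_4⟩
  · exact ⟨_, run_2_3_5⟩
  · exact ⟨_, run_2_4_5⟩
  · exact ⟨_, run_0_1_6⟩
  · exact ⟨_, run_4_5_6⟩
  · exact ⟨_, run_2_6_7⟩
  · exact ⟨_, run_6_7_8⟩

/-! ### The upper bound -/

theorem getD_injOn {L : List ℕ} (hnd : L.Nodup) (hlen : L.length = 11) :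
    Set.InjOn (fun i => L.getD i 0) (Finset.range 11 : Finset ℕ) := by
  intro i hi j hj hij
  have hi' : i < L.length := by rw [hlen]; simpa using hi
  have hj' : j < L.length := by rw [hlen]; simpa using hj
  simp only at hij
  rw [List.getD_eq_getElem _ _ hi', List.getD_eq_getElem _ _ hj'] at hij
  exact (List.Nodup.getElem_inj_iff hnd).1 hij

/-- Some edge is not compatible with the comet on `{a,b,c,x}` with center `x`. -/
theorem exists_noncomet {H : ThreeGraph} (hv : H.IsValid) (hcard : H.verts.card = 11)
    (hco : ¬ (comet 11).ContainsCopy H) {a b c x : ℕ} (hnd : [x, a, b, c].Nodup)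
    (hmem : ∀ v ∈ [x, a, b, c], v ∈ H.verts) :
    ∃ h ∈ H.edges, ¬ h ⊆ {a, b, c, x} ∧ ¬ (x ∈ h ∧ a ∉ h ∧ b ∉ h ∧ c ∉ h) := by
  by_contra hcon
  push Not at hcon
  apply hco
  obtain ⟨L, hL, hlen, hLm, R, hLR, -⟩ := exists_list hcard hnd hmem
  have hget : ∀ v ∈ H.verts, ∀ i, L.idxOf v = i → L[i]? = some v := by
    intro v hvv i hi
    subst hi
    have hlt := List.idxOf_lt_length_of_mem ((hLm v).2 hvv)
    rw [List.getElem?_eq_getElem hlt, List.getElem_idxOf]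
  have hlt : ∀ v ∈ H.verts, L.idxOf v < 11 := by
    intro v hvv
    rw [← hlen]; exact List.idxOf_lt_length_of_mem ((hLm v).2 hvv)
  have hinj : Set.InjOn (fun v => L.idxOf v) (H.verts : Set ℕ) := by
    intro u hu v hvv huv
    have h1 := hget u hu _ rfl
    have h2 := hget v hvv _ rfl
    simp only at huv
    rw [huv, h2] at h1
    exact (Option.some.inj h1).symm
  have hx : L.idxOf x = 0 := by rw [hLR]; simp
  refine ⟨fun v => L.idxOf v, hinj, ?_, ?_⟩
  · intro v hvv
    simpa [comet] using hlt v hvv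
  · intro e he
    have hce : (e.image fun v => L.idxOf v).card = 3 := by
      rw [Finset.card_image_of_injOn (hinj.mono (by exact_mod_cast (hv e he).2)), (hv e he).1]
    simp only [comet, Finset.mem_union, Finset.mem_filter, Finset.mem_powersetCard]
    simp only [List.nodup_cons, List.mem_cons, List.not_mem_nil, or_false, not_or] at hnd
    by_cases hsub : e ⊆ {a, b, c, x}
    · left
      refine ⟨?_, hce⟩
      intro i hi
      obtain ⟨v, hve, rfl⟩ := Finset.mem_image.1 hi
      have := hsub hve
      simp only [Finset.mem_insert, Finset.mem_singleton] at this ⊢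
      rw [hLR]
      rcases this with rfl | rfl | rfl | rfl
      all_goals simp [List.idxOf_cons]
      all_goals grind
    · right
      obtain ⟨h1, h2, h3, h4⟩ := by
        have := hcon e he hsub
        exact this
      refine ⟨⟨?_, hce⟩, ?_⟩
      · intro i hi
        obtain ⟨v, hve, rfl⟩ := Finset.mem_image.1 hi
        have hvv := (hv e he).2 hve
        simp only [Finset.mem_insert, Finset.mem_Ico]
        have l := hlt v hvv
        have g1 : L.idxOf v ≠ 1 := by
          intro h
          have := hget v hvv _ h
          rw [hLR] at this; simp at this; subst this; contradiction
        have g2 : L.idxOf v ≠ 2 := by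
          intro h
          have := hget v hvv _ h
          rw [hLR] at this; simp at this; subst this; contradiction
        have g3 : L.idxOf v ≠ 3 := by
          intro h
          have := hget v hvv _ h
          rw [hLR] at this; simp at this; subst this; contradiction
        omega
      · exact Finset.mem_image.2 ⟨x, h1, hx⟩

theorem core {H : ThreeGraph} (hv : H.IsValid) (hcard : H.verts.card = 11)
    (hP : H.Free pathP) (hC : H.Free triangleC) (hco : ¬ (comet 11).ContainsCopy H)
    {e g f : Finset ℕ} (he : e ∈ H.edges) (hg : g ∈ H.edges) (hf : f ∈ H.edges)
    (h2 : (g ∩ e).card = 2) (h1 : (g ∩ f).card = 1) (h0 : e ∩ f = ∅) :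
    H.edges.card ≤ 18 := by
  have hd : ∀ v, v ∈ e → v ∈ f → False := by
    intro v h h'
    have : v ∈ e ∩ f := Finset.mem_inter.2 ⟨h, h'⟩
    rw [h0] at this; simp at this
  obtain ⟨a, b, hab, hge⟩ := Finset.card_eq_two.1 h2
  obtain ⟨x, hgf⟩ := Finset.card_eq_one.1 h1
  have ha : a ∈ g ∩ e := by simp [hge]
  have hb : b ∈ g ∩ e := by simp [hge]
  have hx : x ∈ g ∩ f := by simp [hgf]
  rw [Finset.mem_inter] at ha hb hx
  obtain ⟨c, hca, hcb, hee⟩ := card_three_split (hv e he).1 ha.2 hb.2 hab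
  obtain ⟨x', hxa, hxb, hgg⟩ := card_three_split (hv g hg).1 ha.1 hb.1 hab
  have hxx : x = x' := by
    have := hx.1
    rw [hgg] at this
    simp only [Finset.mem_insert, Finset.mem_singleton] at this
    rcases this with rfl | rfl | h
    · exact (hd _ ha.2 hx.2).elim
    · exact (hd _ hb.2 hx.2).elim
    · exact h
  subst hxx
  obtain ⟨y, z, hyx, hzx, hzy, hff⟩ := card_three_split_one (hv f hf).1 hx.2
  have hc : c ∈ e := by simp [hee]
  have hy : y ∈ f := by simp [hff]
  have hz : z ∈ f := by simp [hff]
  have sub : ∀ k ∈ H.edges, ∀ v ∈ k, v ∈ H.verts := fun k hk v hvk => (hv k hk).2 hvk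
  have hnd6 : [a, b, c, x, y, z].Nodup := by
    simp only [List.nodup_cons, List.mem_cons, List.not_mem_nil, or_false, not_or,
      List.nodup_nil, and_true, not_false_eq_true]
    grind
  have hmem6 : ∀ v ∈ [a, b, c, x, y, z], v ∈ H.verts := by
    intro v hv6
    simp only [List.mem_cons, List.not_mem_nil, or_false] at hv6
    rcases hv6 with rfl | rfl | rfl | rfl | rfl | rfl
    · exact sub e he _ ha.2
    · exact sub e he _ hb.2
    · exact sub e he _ hc
    · exact sub f hf _ hx.2
    · exact sub f hf _ hy
    · exact sub f hf _ hz
  obtain ⟨h, hh, hh1, hh2⟩ := exists_noncomet hv hcard hco (a := a) (b := b) (c := c) (x := x)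
    (by
      simp only [List.nodup_cons, List.mem_cons, List.not_mem_nil, or_false, not_or,
        List.nodup_nil, and_true, not_false_eq_true] at hnd6 ⊢
      grind)
    (fun v hv4 => hmem6 v (by
      simp only [List.mem_cons, List.not_mem_nil, or_false] at hv4 ⊢; tauto))
  -- the labelling: first the six vertices, then the rest of `h`
  have hT : ∀ v, v ∈ (h \ [a, b, c, x, y, z].toFinset).toList ↔
      v ∈ h ∧ v ∉ [a, b, c, x, y, z] := by
    intro v
    rw [Finset.mem_toList, Finset.mem_sdiff, List.mem_toFinset]
  have hTn := Finset.nodup_toList (h \ [a, b, c, x, y, z].toFinset)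
  generalize (h \ [a, b, c, x, y, z].toFinset).toList = T at hT hTn
  obtain ⟨L, hL, hlen, hLm, R, hLR, hR⟩ := exists_list hcard (P := [a, b, c, x, y, z] ++ T)
    (by
      rw [List.nodup_append]
      refine ⟨hnd6, hTn, ?_⟩
      intro u hu w hw huw
      subst huw
      exact ((hT _).1 hw).2 hu)
    (by
      intro v hvv
      rcases List.mem_append.1 hvv with hvv | hvv
      · exact hmem6 v hvv
      · exact sub h hh _ ((hT v).1 hvv).1)
  have hφ := getD_injOn hL hlen
  have himg : (Finset.range 11).image (fun i => L.getD i 0) = H.verts := by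
    ext v
    rw [← hLm, Finset.mem_image]
    constructor
    · rintro ⟨i, hi, rfl⟩
      have hi' : i < L.length := by rw [hlen]; simpa using hi
      simp only [List.getD_eq_getElem _ _ hi']
      exact List.getElem_mem _
    · intro hvL
      obtain ⟨i, hi, rfl⟩ := List.mem_iff_getElem.1 hvL
      exact ⟨i, by rw [hlen] at hi; simpa using hi, List.getD_eq_getElem _ _ hi⟩
  set φ : ℕ → ℕ := fun i => L.getD i 0 with hφdef
  have p0 : φ 0 = a := by simp [hφdef, hLR]
  have p1 : φ 1 = b := by simp [hφdef, hLR]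
  have p2 : φ 2 = c := by simp [hφdef, hLR]
  have p3 : φ 3 = x := by simp [hφdef, hLR]
  have p4 : φ 4 = y := by simp [hφdef, hLR]
  have p5 : φ 5 = z := by simp [hφdef, hLR]
  have b7 : bits 7 = {0, 1, 2} := by decide +kernel
  have b11 : bits 11 = {0, 1, 3} := by decide +kernel
  have b56 : bits 56 = {3, 4, 5} := by decide +kernel
  have E7 : IsE H φ 7 := by
    refine ⟨by norm_num, ?_⟩
    rw [b7]
    simp only [Finset.image_insert, Finset.image_singleton, p0, p1, p2, ← hee]
    exact he
  have E11 : IsE H φ 11 := by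
    refine ⟨by norm_num, ?_⟩
    rw [b11]
    simp only [Finset.image_insert, Finset.image_singleton, p0, p1, p3, ← hgg]
    exact hg
  have E56 : IsE H φ 56 := by
    refine ⟨by norm_num, ?_⟩
    rw [b56]
    simp only [Finset.image_insert, Finset.image_singleton, p3, p4, p5, ← hff]
    exact hf
  obtain ⟨s1, s2⟩ := exists_labels hv hφ himg hh
  have smem : ∀ i, i < 11 → (i ∈ (Finset.range 11).filter (fun i => φ i ∈ h) ↔ φ i ∈ h) := by
    intro i hi
    simp [hi]
  generalize (Finset.range 11).filter (fun i => φ i ∈ h) = s at s1 s2 smem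
  obtain ⟨m1, m2, m3⟩ := mask_spec s s1
  have Em : IsE H φ (mask s) := ⟨m2, by rw [m3, s2]; exact hh⟩
  have hclosed : ∀ i ∈ Finset.Ico 6 10, i + 1 ∈ s → i ∈ s := by
    intro i hi hs
    rw [Finset.mem_Ico] at hi
    rw [smem _ (by omega)] at hs
    rw [smem _ (by omega)]
    have hlt1 : i + 1 < L.length := by omega
    have hlt : i < L.length := by omega
    have hTi : i + 1 < 6 + T.length := by
      by_contra hcon
      have : φ (i + 1) ∈ R := by
        simp only [hφdef]
        rw [List.getD_eq_getElem _ _ hlt1]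
        simp only [hLR]
        rw [List.getElem_append_right (by simp; omega)]
        exact List.getElem_mem _
      have hn := hR _ this
      rw [List.mem_append, not_or, hT] at hn
      exact hn.2 ⟨hs, hn.1⟩
    have : φ i ∈ T := by
      simp only [hφdef]
      rw [List.getD_eq_getElem _ _ hlt]
      simp only [hLR]
      rw [List.getElem_append_left (by simp; omega)]
      rw [List.getElem_append_right (by simp; omega)]
      exact List.getElem_mem _
    exact ((hT _).1 this).1
  have hn1 : ¬ s ⊆ {0, 1, 2, 3} := by
    intro hss
    apply hh1
    rw [← s2]
    intro v hvv
    obtain ⟨i, hi, rfl⟩ := Finset.mem_image.1 hvv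
    have := hss hi
    simp only [Finset.mem_insert, Finset.mem_singleton] at this ⊢
    rcases this with rfl | rfl | rfl | rfl
    · exact Or.inl p0
    · exact Or.inr (Or.inl p1)
    · exact Or.inr (Or.inr (Or.inl p2))
    · exact Or.inr (Or.inr (Or.inr p3))
  have hn2 : ¬ (3 ∈ s ∧ 0 ∉ s ∧ 1 ∉ s ∧ 2 ∉ s) := by
    rw [smem 3 (by norm_num), smem 0 (by norm_num), smem 1 (by norm_num), smem 2 (by norm_num),
      p0, p1, p2, p3]
    exact hh2
  have hb := isE_bad hv hP hC hφ
  rcases label_cases s s1 hclosed hn1 hn2 with hgood | hbad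
  · obtain ⟨t, ht⟩ := run_all _ hgood
    refine bound hv hP hC hφ himg ht ?_
    intro k hk
    simp only [List.mem_cons, List.not_mem_nil, or_false] at hk
    rcases hk with rfl | rfl | rfl | rfl
    · exact E7
    · exact E11
    · exact E56
    · exact Em
  · rw [hb _ _ _ E7 E11 Em, hb _ _ _ E7 E56 Em, hb _ _ _ E11 E56 Em] at hbad
    simp at hbad

theorem exists_chain {H : ThreeGraph} (hcon : H.Connected) (hv : H.IsValid)
    (hM : H.ContainsCopy matchingM) :
    ∃ e ∈ H.edges, ∃ g ∈ H.edges, ∃ f ∈ H.edges,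
      e ∩ f = ∅ ∧ (g ∩ e).Nonempty ∧ (g ∩ f).Nonempty := by
  by_contra hno
  push Not at hno
  obtain ⟨φ, hφ, -, hE⟩ := hM
  have he0 : ({0, 1, 2} : Finset ℕ).image φ ∈ H.edges := hE _ (by simp [matchingM])
  have hf0 : ({3, 4, 5} : Finset ℕ).image φ ∈ H.edges := hE _ (by simp [matchingM])
  have key : ∀ w, Relation.ReflTransGen (fun a b => ∃ e ∈ H.edges, a ∈ e ∧ b ∈ e) (φ 0) w →
      ∀ k ∈ H.edges, w ∈ k → (k ∩ ({0, 1, 2} : Finset ℕ).image φ).Nonempty := by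
    intro w hw
    induction hw with
    | refl =>
      intro k _ hk
      exact ⟨φ 0, Finset.mem_inter.2 ⟨hk, Finset.mem_image_of_mem _ (by simp)⟩⟩
    | tail hab hbc ih =>
      rename_i u w
      obtain ⟨k', hk', hu, hw'⟩ := hbc
      intro k hk hwk
      have h1 := ih k' hk' hu
      rw [Finset.nonempty_iff_ne_empty]
      intro hemp
      rw [Finset.inter_comm] at hemp
      have := hno _ he0 k' hk' k hk hemp h1
      exact absurd (⟨w, Finset.mem_inter.2 ⟨hw', hwk⟩⟩ : (k' ∩ k).Nonempty)
        (by rw [this]; simp)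
  have h3 : φ 3 ∈ ({3, 4, 5} : Finset ℕ).image φ := Finset.mem_image_of_mem _ (by simp)
  have h0 : φ 0 ∈ ({0, 1, 2} : Finset ℕ).image φ := Finset.mem_image_of_mem _ (by simp)
  obtain ⟨v, hvv⟩ := key (φ 3) (hcon _ ((hv _ he0).2 h0) _ ((hv _ hf0).2 h3)) _ hf0 h3
  obtain ⟨hv1, hv2⟩ := Finset.mem_inter.1 hvv
  obtain ⟨i, hi, rfl⟩ := Finset.mem_image.1 hv1
  obtain ⟨j, hj, hij⟩ := Finset.mem_image.1 hv2
  have hi' : i ∈ (matchingM.verts : Set ℕ) := by simp [matchingM] at hi ⊢; tauto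
  have hj' : j ∈ (matchingM.verts : Set ℕ) := by simp [matchingM] at hj ⊢; tauto
  have := hφ hj' hi' hij
  simp at hi hj
  omega

theorem upper {H : ThreeGraph} (hv : H.IsValid) (hcard : H.verts.card = 11)
    (hcon : H.Connected) (hP : H.Free pathP) (hC : H.Free triangleC)
    (hM : H.ContainsCopy matchingM) (hco : ¬ (comet 11).ContainsCopy H) :
    H.edges.card ≤ 18 := by
  obtain ⟨e, he, g, hg, f, hf, hef, h1, h2⟩ := exists_chain hcon hv hM
  have hsum : (g ∩ e).card + (g ∩ f).card ≤ 3 := by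
    rw [← Finset.card_union_of_disjoint, ← (hv g hg).1]
    · apply Finset.card_le_card
      exact Finset.union_subset Finset.inter_subset_left Finset.inter_subset_left
    · rw [Finset.disjoint_left]
      intro v hv1 hv2
      have : v ∈ e ∩ f :=
        Finset.mem_inter.2 ⟨(Finset.mem_inter.1 hv1).2, (Finset.mem_inter.1 hv2).2⟩
      rw [hef] at this
      simp at this
  have p1 := Finset.card_pos.2 h1
  have p2 := Finset.card_pos.2 h2
  have hne : ¬ ((g ∩ e).card = 1 ∧ (g ∩ f).card = 1) := by
    rintro ⟨q1, q2⟩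
    exact path_of hv hP he hg hf (by rwa [Finset.inter_comm]) q2 hef
  have : ((g ∩ e).card = 2 ∧ (g ∩ f).card = 1) ∨ ((g ∩ f).card = 2 ∧ (g ∩ e).card = 1) := by
    omega
  rcases this with ⟨q1, q2⟩ | ⟨q1, q2⟩
  · exact core hv hcard hP hC hco he hg hf q1 q2 hef
  · exact core hv hcard hP hC hco hf hg he q1 q2 (by rwa [Finset.inter_comm])

/-! ### The extremal example -/

/-- Two sunflowers with kernels `{0,1}` and `{2,3}`. -/
def ex : ThreeGraph :=
  ⟨Finset.range 11,
    ((Finset.range 11).powersetCard 3).filter fun e => (0 ∈ e ∧ 1 ∈ e) ∨ (2 ∈ e ∧ 3 ∈ e)⟩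

theorem ex_valid : ex.IsValid := by
  intro e he
  simp only [ex, Finset.mem_filter, Finset.mem_powersetCard] at he ⊢
  exact ⟨he.1.2, he.1.1⟩

theorem ex_card : ex.edges.card = 18 := by decide +kernel

theorem ex_connected : ex.Connected := by
  have h : ∀ u ∈ Finset.range 11, ∃ e ∈ ex.edges, 0 ∈ e ∧ u ∈ e := by decide +kernel
  intro u hu v hv
  obtain ⟨e, he, h0, hue⟩ := h u hu
  obtain ⟨f, hf, h0', hvf⟩ := h v hv
  exact (Relation.ReflTransGen.single ⟨e, he, hue, h0⟩).tail ⟨f, hf, h0', hvf⟩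

theorem ex_triples : ∀ e ∈ ex.edges, ∀ f ∈ ex.edges, (e ∩ f).card = 1 → ∀ g ∈ ex.edges,
    (f ∩ g).card = 1 → (e ∩ g).card = 2 ∨ (e ∩ g).card = 3 ∨ (e ∩ f ∩ g).card = 1 := by
  decide +kernel

theorem image_inter_card {F : ThreeGraph} {φ : ℕ → ℕ} (hφ : Set.InjOn φ (F.verts : Set ℕ))
    {s t : Finset ℕ} (hs : s ⊆ F.verts) (ht : t ⊆ F.verts) :
    s.image φ ∩ t.image φ = (s ∩ t).image φ ∧ ((s ∩ t).image φ).card = (s ∩ t).card := by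
  constructor
  · rw [Finset.image_inter_of_injOn]
    refine hφ.mono ?_
    intro i hi
    rcases hi with hi | hi
    · exact hs hi
    · exact ht hi
  · apply Finset.card_image_of_injOn
    refine hφ.mono ?_
    intro i hi
    exact hs (Finset.mem_inter.1 hi).1

theorem ex_free {F : ThreeGraph} {A B C : Finset ℕ} (hA : A ∈ F.edges) (hB : B ∈ F.edges)
    (hC : C ∈ F.edges) (sA : A ⊆ F.verts) (sB : B ⊆ F.verts) (sC : C ⊆ F.verts)
    (h1 : (A ∩ B).card = 1) (h2 : (B ∩ C).card = 1)
    (h3 : (A ∩ C).card ≤ 1) (h4 : A ∩ B ∩ C = ∅) : ex.Free F := by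
  rintro ⟨φ, hφ, -, hE⟩
  obtain ⟨i1, c1⟩ := image_inter_card hφ sA sB
  obtain ⟨i2, c2⟩ := image_inter_card hφ sB sC
  obtain ⟨i3, c3⟩ := image_inter_card hφ sA sC
  obtain ⟨i4, c4⟩ := image_inter_card hφ (Finset.inter_subset_left.trans sA : A ∩ B ⊆ _) sC
  have := ex_triples _ (hE A hA) _ (hE B hB) (by rw [i1, c1, h1]) _ (hE C hC)
    (by rw [i2, c2, h2])
  rw [i3, c3, i1, i4, c4, h4] at this
  simp at this
  omega

theorem ex_matching : ex.ContainsCopy matchingM := by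
  refine ⟨fun i => [0, 1, 4, 2, 3, 5].getD i 0, ?_, ?_, ?_⟩
  · have h : ∀ i ∈ matchingM.verts, ∀ j ∈ matchingM.verts,
        [0, 1, 4, 2, 3, 5].getD i 0 = [0, 1, 4, 2, 3, 5].getD j 0 → i = j := by decide +kernel
    intro i hi j hj hij
    exact h i hi j hj hij
  · decide +kernel
  · decide +kernel

theorem ex_not_comet : ¬ (comet 11).ContainsCopy ex := by
  rintro ⟨φ, hφ, -, hE⟩
  have hc : ∀ k ∈ (comet 11).edges, 0 ∉ k → k = {1, 2, 3} := by decide +kernel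
  have key : ∀ e ∈ ex.edges, ∀ f ∈ ex.edges, (∀ v ∈ e, φ v ≠ 0) → (∀ v ∈ f, φ v ≠ 0) →
      e = f := by
    intro e he f hf h1 h2
    have q1 := hc _ (hE e he) (by
      intro h; obtain ⟨v, hv, h0⟩ := Finset.mem_image.1 h; exact h1 v hv h0)
    have q2 := hc _ (hE f hf) (by
      intro h; obtain ⟨v, hv, h0⟩ := Finset.mem_image.1 h; exact h2 v hv h0)
    have hsub : ∀ {e f : Finset ℕ}, e ∈ ex.edges → f ∈ ex.edges → e.image φ = f.image φ →
        e ⊆ f := by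
      intro e f he hf heq v hv
      have : φ v ∈ f.image φ := by rw [← heq]; exact Finset.mem_image_of_mem _ hv
      obtain ⟨w, hw, hwv⟩ := Finset.mem_image.1 this
      rwa [← hφ ((ex_valid f hf).2 hw) ((ex_valid e he).2 hv) hwv]
    exact Finset.Subset.antisymm (hsub he hf (q1.trans q2.symm)) (hsub hf he (q2.trans q1.symm))
  have two : ∀ u ∈ ex.verts, ∃ e ∈ ex.edges, ∃ f ∈ ex.edges, e ≠ f ∧ u ∉ e ∧ u ∉ f := by
    decide +kernel
  have hu : ∃ u ∈ ex.verts, ∀ v ∈ ex.verts, φ v = 0 → v = u := by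
    by_cases h : ∃ u ∈ ex.verts, φ u = 0
    · obtain ⟨u, hu, h0⟩ := h
      exact ⟨u, hu, fun v hv hv0 => hφ hv hu (hv0.trans h0.symm)⟩
    · push Not at h
      exact ⟨0, by decide +kernel, fun v hv hv0 => absurd hv0 (h v hv)⟩
  obtain ⟨u, hu, huu⟩ := hu
  obtain ⟨e, he, f, hf, hne, h1, h2⟩ := two u hu
  apply hne
  refine key e he f hf ?_ ?_
  · intro v hv h0
    exact h1 (huu v ((ex_valid e he).2 hv) h0 ▸ hv)
  · intro v hv h0
    exact h2 (huu v ((ex_valid f hf).2 hv) h0 ▸ hv)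

end Eleven

/-- The maximum number of edges of a connected `{P,C}`-free 3-graph on 11 vertices
containing `M` and not contained in the comet `Co(11)` equals 18. -/
theorem conn_cond_turan_eleven :
    IsGreatest {m : ℕ | ∃ H : ThreeGraph, H.IsValid ∧ H.verts.card = 11 ∧
      H.Connected ∧ H.Free pathP ∧ H.Free triangleC ∧
      H.ContainsCopy matchingM ∧ ¬ (comet 11).ContainsCopy H ∧
      H.edges.card = m} 18 := by
  constructor
  · refine ⟨Eleven.ex, Eleven.ex_valid, by simp [Eleven.ex], Eleven.ex_connected, ?_, ?_,
      Eleven.ex_matching, Eleven.ex_not_comet, Eleven.ex_card⟩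
    · exact Eleven.ex_free (F := pathP) (A := {0, 1, 2}) (B := {2, 3, 4}) (C := {4, 5, 6})
        (by decide +kernel) (by decide +kernel) (by decide +kernel) (by decide +kernel)
        (by decide +kernel) (by decide +kernel) (by decide +kernel) (by decide +kernel)
        (by decide +kernel) (by decide +kernel)
    · exact Eleven.ex_free (F := triangleC) (A := {0, 1, 2}) (B := {2, 3, 4}) (C := {4, 5, 0})
        (by decide +kernel) (by decide +kernel) (by decide +kernel) (by decide +kernel)
        (by decide +kernel) (by decide +kernel) (by decide +kernel) (by decide +kernel)
        (by decide +kernel) (by decide +kernel)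
  · rintro m ⟨H, hv, hcard, hcon, hP, hC, hM, hco, rfl⟩
    exact Eleven.upper hv hcard hcon hP hC hM hco
end
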